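/- (Relation R6, the Serre relations, of the intermediate Wakimoto realization.) For all 1 ≤ i, j ≤ n with (α_i|α_j) = −1 (i.e. |i − j| = 1) and all m₁, m₂, p ∈ ℤ, [ρ(E_i)_{m₁}, [ρ(E_i)_{m₂}, ρ(E_j)_p]] = 0 and [ρ(F_i)_{m₁}, [ρ(F_i)_{m₂}, ρ(F_j)_p]] = 0 as linear operators on ℂ[x] ⊗ ℂ[y]. -/

import Mathlib

open MvPolynomial

/-- The Cartan matrix of `sl(n+1, ℂ)` (indices `0, …, n-1` represent `1, …, n`). -/
def cartan (n : ℕ) (i j : Fin n) : ℤ :=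
  if i = j then 2 else if (i : ℕ) + 1 = (j : ℕ) ∨ (j : ℕ) + 1 = (i : ℕ) then -1 else 0

/-- The pairing `(α_i | α_{kl}) = Σ_{s=k}^{l} A_{is}` of a simple root with the positive
root `α_k + ⋯ + α_l`. -/
def pairRoot (n : ℕ) (i k l : Fin n) : ℤ :=
  ∑ s ∈ Finset.Icc k l, cartan n i s

/-- The matrix `𝔅_{ij} = (α_i|α_j)(γ² − δ_{i>r}δ_{j>r}(r+1) + (r/2)δ_{i,r+1}δ_{j,r+1})`. -/
noncomputable def Bmat (n r : ℕ) (γ : ℂ) (i j : Fin n) : ℂ :=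
  (cartan n i j : ℂ) *
    (γ ^ 2 - (if r < (i : ℕ) + 1 ∧ r < (j : ℕ) + 1 then (r : ℂ) + 1 else 0)
      + (if (i : ℕ) = r ∧ (j : ℕ) = r then (r : ℂ) / 2 else 0))

/-- Index type for the variables of `ℂ[x] ⊗ ℂ[y] ≅ ℂ[x, y]`:  left summands index the
variables `x_{ij,m}` (`1 ≤ i ≤ j ≤ n`, `m ∈ ℤ`; only indices with `i ≤ j` are used),
right summands index the variables `y_{i,m}` (`1 ≤ i ≤ n`, `m ≥ 1`). -/
abbrev Idx (n : ℕ) := (Fin n × Fin n × ℤ) ⊕ (Fin n × ℕ+)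

/-- The Fock space `ℂ[x] ⊗ ℂ[y]`, realized as a polynomial ring in both families of
variables. -/
abbrev PXY (n : ℕ) := MvPolynomial (Idx n) ℂ

/-- The oscillator operator `a_{ij,m} ⊗ 1`. -/
noncomputable def aOp (n r : ℕ) (i j : Fin n) (m : ℤ) : Module.End ℂ (PXY n) :=
  if 0 ≤ m ∧ (j : ℕ) + 1 ≤ r then (pderiv (Sum.inl (i, j, m))).toLinearMap
  else LinearMap.mulLeft ℂ (X (Sum.inl (i, j, m)))

/-- The oscillator operator `a*_{ij,m} ⊗ 1`. -/
noncomputable def aStar (n r : ℕ) (i j : Fin n) (m : ℤ) : Module.End ℂ (PXY n) :=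
  if m ≤ 0 ∧ (j : ℕ) + 1 ≤ r then LinearMap.mulLeft ℂ (X (Sum.inl (i, j, -m)))
  else - (pderiv (Sum.inl (i, j, -m))).toLinearMap

/-- The Heisenberg operator `1 ⊗ b_{i,m}`. -/
noncomputable def bOp (n : ℕ) (e : Fin n → Fin n → ℂ) (lam : Fin n → ℂ)
    (i : Fin n) (m : ℤ) : Module.End ℂ (PXY n) :=
  if hm : 0 < m then
    (m : ℂ) • ∑ k : Fin n, e i k • (pderiv (Sum.inr (k, (⟨m.toNat, by omega⟩ : ℕ+)))).toLinearMap
  else if hm' : m < 0 then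
    ∑ k : Fin n, e i k • LinearMap.mulLeft ℂ (X (Sum.inr (k, (⟨(-m).toNat, by omega⟩ : ℕ+))))
  else lam i • (1 : Module.End ℂ (PXY n))

/-- The normally ordered quadratic operator `N_{kl,m} = Σ_{q∈ℤ} :a_{kl,q} a*_{kl,m-q}:`
(pointwise `finsum`). -/
noncomputable def Nop (n r : ℕ) (k l : Fin n) (m : ℤ) (P : PXY n) : PXY n :=
  ∑ᶠ q : ℤ,
    if 0 ≤ q ∧ (l : ℕ) + 1 ≤ r then aStar n r k l (m - q) (aOp n r k l q P)
    else aOp n r k l q (aStar n r k l (m - q) P)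

/-- The operator `ℋ_{i,m} = Σ_{1 ≤ k ≤ l ≤ n} (α_i|α_{kl}) N_{kl,m}`. -/
noncomputable def Hcal (n r : ℕ) (i : Fin n) (m : ℤ) (P : PXY n) : PXY n :=
  ∑ k : Fin n, ∑ l : Fin n,
    if k ≤ l then (pairRoot n i k l : ℂ) • Nop n r k l m P else 0

/-- The quadratic operator `(a_{kl} a*_{k'l'})_m = Σ_{q∈ℤ} a_{kl,q} a*_{k'l',m-q}`. -/
noncomputable def pairOp (n r : ℕ) (k l k' l' : Fin n) (m : ℤ) (P : PXY n) : PXY n :=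
  ∑ᶠ q : ℤ, aOp n r k l q (aStar n r k' l' (m - q) P)

/-- `Σ_{k=1}^{i-1} (a_{k,i-1} a*_{k,i})_m`. -/
noncomputable def sumLow (n r : ℕ) (i : Fin n) (m : ℤ) (P : PXY n) : PXY n :=
  ∑ k : Fin n, if h : k < i then
    pairOp n r k (⟨(i : ℕ) - 1, by have := i.isLt; omega⟩ : Fin n) k i m P
  else 0

/-- `Σ_{k=i+1}^{n} (a_{i+1,k} a*_{i,k})_m`. -/
noncomputable def sumHigh (n r : ℕ) (i : Fin n) (m : ℤ) (P : PXY n) : PXY n :=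
  ∑ k : Fin n, if h : i < k then
    pairOp n r (⟨(i : ℕ) + 1, by have := k.isLt; have := Fin.lt_def.mp h; omega⟩ : Fin n)
      k i k m P
  else 0

/-- `Σ_{j=i+1}^{n} (a_{i,j} a*_{i+1,j})_m`, the quadratic part of `ρ(F_i)_m`. -/
noncomputable def sumF (n r : ℕ) (i : Fin n) (m : ℤ) (P : PXY n) : PXY n :=
  ∑ j : Fin n, if h : i < j then
    pairOp n r i j (⟨(i : ℕ) + 1, by have := j.isLt; have := Fin.lt_def.mp h; omega⟩ : Fin n)
      j m P
  else 0

/-- `a_{jl,q}` is an annihilation operator iff `q ≥ 0` and `l ≤ r`. -/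
def annAFlag (r : ℕ) {n : ℕ} (l : Fin n) (q : ℤ) : Bool :=
  decide (0 ≤ q ∧ (l : ℕ) + 1 ≤ r)

/-- `a*_{jl,q}` is an annihilation operator iff `q > 0` or `l > r`. -/
def annSFlag (r : ℕ) {n : ℕ} (l : Fin n) (q : ℤ) : Bool :=
  ! decide (q ≤ 0 ∧ (l : ℕ) + 1 ≤ r)

/-- Normally ordered product of three operators (each tagged with its annihilation flag):
annihilation operators are placed to the right of creation operators. -/
noncomputable def nord3 {n : ℕ} (f1 f2 f3 : Module.End ℂ (PXY n) × Bool) :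
    Module.End ℂ (PXY n) :=
  (([f1, f2, f3].filter fun p => !p.2).map Prod.fst).prod *
    (([f1, f2, f3].filter fun p => p.2).map Prod.fst).prod

/-- The mode of `:a*_{ii}(z) a_{kl}(z) a*_{kl}(z):` of `z`-degree `-m-1`. -/
noncomputable def cubic (n r : ℕ) (i k l : Fin n) (m : ℤ) (P : PXY n) : PXY n :=
  ∑ᶠ q : ℤ × ℤ,
    nord3 (aStar n r i i q.1, annSFlag r i q.1)
      (aOp n r k l q.2, annAFlag r l q.2)
      (aStar n r k l (m - q.1 - q.2), annSFlag r l (m - q.1 - q.2)) P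

/-- The mode `ρ(E_i)_m`, the coefficient of `z^{-m-1}` in
`E_i(z) = :a*_{ii}(Σ_{k<i} a_{k,i-1}a*_{k,i-1} − Σ_{k≤i} a_{ki}a*_{ki}):
+ Σ_{k>i} a_{i+1,k}a*_{ik} − Σ_{k<i} a_{k,i-1}a*_{ki} − a*_{ii} b_i
− (δ_{i>r}(r+1) + δ_{i≤r}(i+1) − γ²) ∂a*_{ii}`. -/
noncomputable def rhoE (n r : ℕ) (γ : ℂ) (e : Fin n → Fin n → ℂ) (lam : Fin n → ℂ)
    (i : Fin n) (m : ℤ) (P : PXY n) : PXY n :=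
  (∑ k : Fin n, if h : k < i then
      cubic n r i k (⟨(i : ℕ) - 1, by have := i.isLt; omega⟩ : Fin n) m P
    else 0)
  - (∑ k : Fin n, if k ≤ i then cubic n r i k i m P else 0)
  + sumHigh n r i m P
  - sumLow n r i m P
  - (∑ᶠ q : ℤ, aStar n r i i q (bOp n e lam i (m - q) P))
  - ((if r < (i : ℕ) + 1 then (r : ℂ) + 1 else 0)
      + (if (i : ℕ) + 1 ≤ r then ((i : ℕ) : ℂ) + 2 else 0) - γ ^ 2) •
      ((-(m : ℂ)) • aStar n r i i m P)

/-- The mode `ρ(H_i)_m = ℋ_{i,m} ⊗ 1 + 1 ⊗ b_{i,m}`. -/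
noncomputable def rhoH (n r : ℕ) (e : Fin n → Fin n → ℂ) (lam : Fin n → ℂ)
    (i : Fin n) (m : ℤ) (P : PXY n) : PXY n :=
  Hcal n r i m P + bOp n e lam i m P

/-- The mode `ρ(F_i)_m = a_{ii,m} ⊗ 1 + Σ_{j=i+1}^{n} (a_{ij} a*_{i+1,j})_m ⊗ 1`. -/
noncomputable def rhoF (n r : ℕ) (i : Fin n) (m : ℤ) (P : PXY n) : PXY n :=
  aOp n r i i m P + sumF n r i m P

section LocallyFiniteSums

variable {V : Type*} [AddCommGroup V] [Module ℂ V] {ι κ : Type*}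

instance endLieRing : LieRing (Module.End ℂ V) := LieRing.ofAssociativeRing

instance endBracket : Bracket (Module.End ℂ V) (Module.End ℂ V) := LieRing.toBracket

instance endLieAlgebra : LieAlgebra ℂ (Module.End ℂ V) := LieAlgebra.ofAssociativeAlgebra

/-- A family of operators is locally finite if only finitely many members act nontrivially on
each vector. -/
def LocFin (T : ι → Module.End ℂ V) : Prop :=
  ∀ P, (Function.support fun q => T q P).Finite

open Classical in
/-- The pointwise sum of a locally finite family of operators (`0` for other families). -/
noncomputable def LSum (T : ι → Module.End ℂ V) : Module.End ℂ V :=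
  if h : LocFin T then
    { toFun := fun P => ∑ᶠ q, T q P
      map_add' := fun P Q => by
        simp only [map_add]
        exact finsum_add_distrib (h P) (h Q)
      map_smul' := fun c P => by
        simp only [map_smul, RingHom.id_apply]
        exact (smul_finsum' c (h P)).symm }
  else 0

theorem LSum_apply {T : ι → Module.End ℂ V} (h : LocFin T) (P : V) :
    LSum T P = ∑ᶠ q, T q P := by
  simp [LSum, h]

theorem LocFin.add {S T : ι → Module.End ℂ V} (hS : LocFin S) (hT : LocFin T) :
    LocFin fun q => S q + T q := fun P =>
  ((hS P).union (hT P)).subset (Function.support_add _ _)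

theorem LocFin.mul_left {T : ι → Module.End ℂ V} (hT : LocFin T) (φ : Module.End ℂ V) :
    LocFin fun q => φ * T q := fun P =>
  (hT P).subset fun q hq hq' => hq (by
    simp only [] at hq'
    simp [Module.End.mul_apply, hq'])

theorem LocFin.mul_right {T : ι → Module.End ℂ V} (hT : LocFin T) (φ : Module.End ℂ V) :
    LocFin fun q => T q * φ := fun P => hT (φ P)

theorem LocFin.neg {T : ι → Module.End ℂ V} (hT : LocFin T) : LocFin fun q => -T q := by
  simpa using hT.mul_left (-1)

theorem LocFin.smul {T : ι → Module.End ℂ V} (hT : LocFin T) (c : ℂ) :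
    LocFin fun q => c • T q := by
  simpa using hT.mul_left (c • 1)

theorem LSum_add {S T : ι → Module.End ℂ V} (hS : LocFin S) (hT : LocFin T) :
    LSum (fun q => S q + T q) = LSum S + LSum T := by
  ext P
  rw [LinearMap.add_apply, LSum_apply hS, LSum_apply hT, LSum_apply (hS.add hT)]
  exact finsum_add_distrib (hS P) (hT P)

theorem LSum_mul_left {T : ι → Module.End ℂ V} (hT : LocFin T) (φ : Module.End ℂ V) :
    LSum (fun q => φ * T q) = φ * LSum T := by
  ext P
  rw [Module.End.mul_apply, LSum_apply hT, LSum_apply (hT.mul_left φ)]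
  exact (AddMonoidHom.map_finsum φ.toAddMonoidHom (hT P)).symm

theorem LSum_mul_right {T : ι → Module.End ℂ V} (hT : LocFin T) (φ : Module.End ℂ V) :
    LSum (fun q => T q * φ) = LSum T * φ := by
  ext P
  rw [Module.End.mul_apply, LSum_apply hT, LSum_apply (hT.mul_right φ)]
  rfl

theorem LSum_smul {T : ι → Module.End ℂ V} (hT : LocFin T) (c : ℂ) :
    LSum (fun q => c • T q) = c • LSum T := by
  simpa using LSum_mul_left hT (c • 1)

theorem LSum_neg {T : ι → Module.End ℂ V} (hT : LocFin T) :
    LSum (fun q => -T q) = -LSum T := by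
  simpa using LSum_mul_left hT (-1)

theorem LSum_sub {S T : ι → Module.End ℂ V} (hS : LocFin S) (hT : LocFin T) :
    LSum (fun q => S q - T q) = LSum S - LSum T := by
  simp only [sub_eq_add_neg]
  rw [LSum_add hS hT.neg, LSum_neg hT]

theorem lie_LSum {T : ι → Module.End ℂ V} (hT : LocFin T) (φ : Module.End ℂ V) :
    ⁅φ, LSum T⁆ = LSum fun q => ⁅φ, T q⁆ := by
  simp only [Ring.lie_def]
  rw [LSum_sub (hT.mul_left φ) (hT.mul_right φ), LSum_mul_left hT, LSum_mul_right hT]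

theorem LSum_lie {T : ι → Module.End ℂ V} (hT : LocFin T) (φ : Module.End ℂ V) :
    ⁅LSum T, φ⁆ = LSum fun q => ⁅T q, φ⁆ := by
  simp only [Ring.lie_def]
  rw [LSum_sub (hT.mul_right φ) (hT.mul_left φ), LSum_mul_left hT, LSum_mul_right hT]

theorem locFin_zero : LocFin fun _ : ι => (0 : Module.End ℂ V) := fun P => by
  simp

@[simp] theorem LSum_zero : LSum (fun _ : ι => (0 : Module.End ℂ V)) = 0 := by
  ext P
  rw [LSum_apply locFin_zero]
  simp

theorem locFin_comp_iff {T : ι → Module.End ℂ V} {f : κ → ι} (hf : Function.Injective f)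
    (h0 : ∀ q, q ∉ Set.range f → T q = 0) : LocFin (fun q => T (f q)) ↔ LocFin T := by
  refine forall_congr' fun P => ?_
  have : (Function.support fun q => T q P) = f '' (Function.support fun q => T (f q) P) := by
    ext q
    simp only [Function.mem_support, Set.mem_image]
    constructor
    · intro hq
      by_cases hr : q ∈ Set.range f
      · obtain ⟨p, rfl⟩ := hr
        exact ⟨p, hq, rfl⟩
      · exact absurd (by rw [h0 q hr]; rfl) hq
    · rintro ⟨p, hp, rfl⟩
      exact hp
  rw [this, Set.finite_image_iff hf.injOn]

/-- Reindexing along an injection whose range contains the support of the family. -/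
theorem LSum_comp {T : ι → Module.End ℂ V} {f : κ → ι} (hf : Function.Injective f)
    (h0 : ∀ q, q ∉ Set.range f → T q = 0) : LSum (fun q => T (f q)) = LSum T := by
  by_cases h : LocFin T
  · ext P
    rw [LSum_apply h, LSum_apply ((locFin_comp_iff hf h0).2 h),
      ← finsum_mem_range (f := fun q => T q P) hf, ← finsum_mem_univ (f := fun q => T q P)]
    refine finsum_mem_inter_support_eq' _ _ _ fun q hq => ?_
    simp only [Set.mem_univ, iff_true]
    by_contra hr
    exact hq (by simp [h0 q hr])
  · have h' : ¬LocFin fun q => T (f q) := fun H => h ((locFin_comp_iff hf h0).1 H)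
    simp only [LSum, dif_neg h, dif_neg h']

theorem LSum_single {T : ι → Module.End ℂ V} (q₀ : ι) (h0 : ∀ q, q ≠ q₀ → T q = 0) :
    LSum T = T q₀ := by
  have h : LocFin T := fun P => (Set.finite_singleton q₀).subset fun q hq => by
    by_contra hne
    exact hq (by simp [h0 q hne])
  ext P
  rw [LSum_apply h]
  exact finsum_eq_single _ q₀ fun q hq => by simp [h0 q hq]

end LocallyFiniteSums

section Generators

variable {n : ℕ}

/-- The Fock space as a plain vector space. -/
def Fock (n : ℕ) : Type := PXY n

noncomputable instance : AddCommGroup (Fock n) := inferInstanceAs (AddCommGroup (PXY n))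

noncomputable instance : Module ℂ (Fock n) := inferInstanceAs (Module ℂ (PXY n))

/-- Multiplication by a variable. -/
noncomputable def mulX (v : Idx n) : Module.End ℂ (Fock n) :=
  (LinearMap.mulLeft ℂ (X v) : Module.End ℂ (PXY n))

/-- Differentiation with respect to a variable. -/
noncomputable def der (v : Idx n) : Module.End ℂ (Fock n) :=
  ((pderiv v).toLinearMap : Module.End ℂ (PXY n))

theorem der_apply (v : Idx n) (P : PXY n) : der v P = (pderiv v P : PXY n) := rfl

theorem lie_mulX_mulX (v w : Idx n) : ⁅mulX v, mulX w⁆ = 0 := by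
  refine LinearMap.ext fun P => ?_
  exact sub_eq_zero.2 (mul_left_comm (X v : PXY n) (X w) P)

theorem pderiv_comm (v w : Idx n) (P : PXY n) : pderiv v (pderiv w P) = pderiv w (pderiv v P) := by
  have h : ⁅(pderiv v : Derivation ℂ (PXY n) (PXY n)), (pderiv w : Derivation ℂ (PXY n) (PXY n))⁆
      = 0 := by
    refine MvPolynomial.derivation_ext fun i => ?_
    simp only [Derivation.commutator_apply, pderiv_X, Pi.single_apply]
    split_ifs <;> simp
  have := congrArg (fun D : Derivation ℂ (PXY n) (PXY n) => D P) h
  simpa [Derivation.commutator_apply, sub_eq_zero] using this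

theorem lie_der_der (v w : Idx n) : ⁅der v, der w⁆ = 0 := by
  refine LinearMap.ext fun P => ?_
  exact sub_eq_zero.2 (pderiv_comm v w P)

theorem lie_der_mulX (v w : Idx n) : ⁅der v, mulX w⁆ = (if v = w then (1 : ℂ) else 0) • 1 := by
  have key (P : PXY n) : pderiv v (X w * P) - X w * pderiv v P =
      (if v = w then (1 : ℂ) else 0) • P := by
    rw [Derivation.leibniz, pderiv_X, Pi.single_apply]
    by_cases h : v = w
    · simp [h]
    · simp [h, Ne.symm h]
  exact LinearMap.ext fun P => key P

theorem lie_mulX_der (v w : Idx n) :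
    ⁅mulX v, der w⁆ = (-if v = w then (1 : ℂ) else 0) • 1 := by
  rw [← lie_skew, lie_der_mulX, neg_smul]
  simp [eq_comm]

/-- An operator commuting with all multiplications and all derivations is a scalar. -/
theorem eq_smul_one_of_lie_eq_zero {T : Module.End ℂ (Fock n)} (hX : ∀ v : Idx n, ⁅T, mulX v⁆ = 0)
    (hd : ∀ v : Idx n, ⁅T, der v⁆ = 0) : ∃ c : ℂ, T = c • 1 := by
  obtain ⟨S, rfl⟩ : ∃ S : Module.End ℂ (PXY n), S = T := ⟨T, rfl⟩
  have hX' : ∀ v P, S (X v * P) = X v * S P := fun v P =>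
    sub_eq_zero.1 (LinearMap.congr_fun (hX v) P)
  have hd' : ∀ v, pderiv v (S 1) = 0 := fun v => by
    have := sub_eq_zero.1 (LinearMap.congr_fun (hd v) (1 : PXY n))
    change S (pderiv v 1) = pderiv v (S 1) at this
    rw [← this, pderiv_one, map_zero]
  have h1 : S 1 = C (coeff 0 (S 1)) := by
    ext m
    rw [coeff_C]
    split_ifs with h
    · rw [h]
    · obtain ⟨v, hv⟩ : ∃ v, m v ≠ 0 := by
        by_contra! H
        exact h (Finsupp.ext fun v => (H v).symm)
      have hm : m - Finsupp.single v 1 + Finsupp.single v 1 = m :=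
        tsub_add_cancel_of_le (Finsupp.single_le_iff.2 (Nat.one_le_iff_ne_zero.2 hv))
      have := congrArg (coeff (m - Finsupp.single v 1)) (hd' v)
      rw [coeff_pderiv, hm, coeff_zero] at this
      rcases mul_eq_zero.1 this with h0 | h0
      · exact h0
      · exact absurd h0 (Nat.cast_add_one_ne_zero _)
  refine ⟨coeff 0 (S 1), LinearMap.ext fun P => ?_⟩
  change S P = (coeff 0 (S 1) • P : PXY n)
  change PXY n at P
  induction P using MvPolynomial.induction_on with
  | C a =>
    have : (C a : PXY n) = a • 1 := by rw [smul_eq_C_mul, mul_one]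
    rw [this, map_smul]
    conv_lhs => rw [h1]
    simp [smul_eq_C_mul, mul_comm]
  | add p q hp hq => rw [map_add, smul_add, hp, hq]
  | mul_X p v hp => rw [mul_comm p, hX', hp, mul_smul_comm]

variable (n) (r : ℕ)

/-- `aOp` with natural number indices, zero outside of the index range. -/
noncomputable def aM (u : ℕ × ℕ) (q : ℤ) : Module.End ℂ (Fock n) :=
  if h : u.1 < n ∧ u.2 < n then
    if 0 ≤ q ∧ u.2 + 1 ≤ r then der (Sum.inl (⟨u.1, h.1⟩, ⟨u.2, h.2⟩, q))
    else mulX (Sum.inl (⟨u.1, h.1⟩, ⟨u.2, h.2⟩, q))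
  else 0

/-- `aStar` with natural number indices, zero outside of the index range. -/
noncomputable def sM (u : ℕ × ℕ) (q : ℤ) : Module.End ℂ (Fock n) :=
  if h : u.1 < n ∧ u.2 < n then
    if q ≤ 0 ∧ u.2 + 1 ≤ r then mulX (Sum.inl (⟨u.1, h.1⟩, ⟨u.2, h.2⟩, -q))
    else -der (Sum.inl (⟨u.1, h.1⟩, ⟨u.2, h.2⟩, -q))
  else 0

/-- A positive integer as an element of `ℕ+`. -/
def toPos (t : ℤ) (ht : 0 < t) : ℕ+ := ⟨t.toNat, by omega⟩

theorem toPos_inj {s t : ℤ} (hs : 0 < s) (ht : 0 < t) : toPos s hs = toPos t ht ↔ s = t := by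
  refine Subtype.ext_iff.trans ?_
  simp only [toPos]
  omega

/-- The oscillators in the variables `y_k`. -/
noncomputable def yM (k : Fin n) (t : ℤ) : Module.End ℂ (Fock n) :=
  if ht : 0 < t then (t : ℂ) • der (Sum.inr (k, toPos t ht))
  else if ht : t < 0 then mulX (Sum.inr (k, toPos (-t) (by omega)))
  else 0

variable {n} {r}

theorem lie_a_a (u w : ℕ × ℕ) (p q : ℤ) : ⁅aM n r u p, aM n r w q⁆ = 0 := by
  unfold aM
  split_ifs <;> simp only [zero_lie, lie_zero, lie_der_der, lie_mulX_mulX, lie_der_mulX,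
    lie_mulX_der, Sum.inl.injEq, Prod.mk.injEq, Fin.mk.injEq]
  all_goals
    rw [if_neg (by omega)]
    simp

theorem lie_s_s (u w : ℕ × ℕ) (p q : ℤ) : ⁅sM n r u p, sM n r w q⁆ = 0 := by
  unfold sM
  split_ifs <;> simp only [zero_lie, lie_zero, lie_neg, neg_lie, lie_der_der, lie_mulX_mulX,
    lie_der_mulX, lie_mulX_der, Sum.inl.injEq, Prod.mk.injEq, Fin.mk.injEq]
  all_goals try simp only [neg_zero]
  all_goals
    rw [if_neg (by omega)]
    simp

theorem lie_a_s' (u w : ℕ × ℕ) (p q : ℤ) : ⁅aM n r u p, sM n r w q⁆ =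
    (if u = w ∧ (u.1 < n ∧ u.2 < n) ∧ p + q = 0 then (1 : ℂ) else 0) • 1 := by
  by_cases hu : u.1 < n ∧ u.2 < n
  swap
  · simp [aM, hu]
  by_cases hw : w.1 < n ∧ w.2 < n
  swap
  · rw [if_neg (by rintro ⟨rfl, h, -⟩; exact hw h)]
    simp [sM, hw]
  obtain ⟨u1, u2⟩ := u
  obtain ⟨w1, w2⟩ := w
  unfold sM aM
  rw [dif_pos hu, dif_pos hw]
  simp only at hu hw
  split_ifs <;> simp only [lie_neg, lie_der_der, lie_mulX_mulX, lie_der_mulX, lie_mulX_der,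
    Sum.inl.injEq, Prod.mk.injEq, Fin.mk.injEq] at * <;>
    (try split_ifs) <;> first | (exfalso; omega) | simp

theorem lie_a_s (u w : ℕ × ℕ) (hw : w.1 < n ∧ w.2 < n) (p q : ℤ) : ⁅aM n r u p, sM n r w q⁆ =
    (if u = w ∧ p + q = 0 then (1 : ℂ) else 0) • 1 := by
  rw [lie_a_s']
  congr 2
  rw [eq_iff_iff]
  exact ⟨fun h => ⟨h.1, h.2.2⟩, fun h => ⟨h.1, h.1 ▸ hw, h.2⟩⟩

theorem lie_s_a (u w : ℕ × ℕ) (hw : w.1 < n ∧ w.2 < n) (p q : ℤ) : ⁅sM n r u p, aM n r w q⁆ =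
    (if w = u ∧ p + q = 0 then (-1 : ℂ) else 0) • 1 := by
  rw [← lie_skew, lie_a_s', ← neg_smul, add_comm p]
  congr 1
  by_cases h : w = u ∧ q + p = 0
  · rw [if_pos h, if_pos ⟨h.1, hw, h.2⟩]
  · rw [if_neg h, if_neg fun h' => h ⟨h'.1, h'.2.2⟩, neg_zero]

theorem lie_a_y (u : ℕ × ℕ) (k : Fin n) (p q : ℤ) : ⁅aM n r u p, yM n k q⁆ = 0 := by
  unfold aM yM
  split_ifs <;> simp [lie_der_der, lie_mulX_mulX, lie_der_mulX, lie_mulX_der]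

theorem lie_s_y (u : ℕ × ℕ) (k : Fin n) (p q : ℤ) : ⁅sM n r u p, yM n k q⁆ = 0 := by
  unfold sM yM
  split_ifs <;> simp [lie_der_der, lie_mulX_mulX, lie_der_mulX, lie_mulX_der]

theorem lie_y_y (k l : Fin n) (p q : ℤ) : ⁅yM n k p, yM n l q⁆ =
    (if k = l ∧ p + q = 0 then (p : ℂ) else 0) • 1 := by
  have key (k l : Fin n) (p q : ℤ) (hp : 0 < p) (hq : q < 0) : ⁅yM n k p, yM n l q⁆ =
      (if k = l ∧ p + q = 0 then (p : ℂ) else 0) • 1 := by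
    have e : p = -q ↔ p + q = 0 := by omega
    rw [yM, yM, dif_pos hp, dif_neg (by omega), dif_pos hq, smul_lie, lie_der_mulX, smul_smul]
    simp only [Sum.inr.injEq, Prod.mk.injEq, toPos_inj, e, mul_ite, mul_one, mul_zero]
  have key0 (k : Fin n) : yM n k 0 = 0 := by simp [yM]
  rcases lt_trichotomy p 0 with hp | rfl | hp
  · rcases lt_trichotomy q 0 with hq | rfl | hq
    · rw [if_neg (by omega), yM, yM, dif_neg (not_lt.2 hp.le), dif_neg (not_lt.2 hq.le), dif_pos hp,
        dif_pos hq, lie_mulX_mulX, zero_smul]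
    · rw [key0, if_neg (by omega), lie_zero, zero_smul]
    · rw [← lie_skew, key l k q p hq hp, ← neg_smul]
      congr 1
      by_cases h : k = l ∧ p + q = 0
      · rw [if_pos h, if_pos ⟨h.1.symm, by omega⟩, ← Int.cast_neg, Int.cast_inj]
        omega
      · rw [if_neg h, if_neg fun h' => h ⟨h'.1.symm, by omega⟩, neg_zero]
  · simp [key0]
  · rcases lt_trichotomy q 0 with hq | rfl | hq
    · exact key k l p q hp hq
    · rw [key0, if_neg (by omega), lie_zero, zero_smul]
    · rw [if_neg (by omega), yM, yM, dif_pos hp, dif_pos hq, smul_lie, lie_smul,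
        lie_der_der, smul_zero, smul_zero, zero_smul]

end Generators

section LocalFiniteness

variable {n r : ℕ}

/-- The mode of a variable. -/
def mode : Idx n → ℤ
  | Sum.inl (_, _, m) => m
  | Sum.inr (_, d) => (d : ℤ)

/-- All variables occurring in `P` have mode at most `N` in absolute value. -/
def Bd (N : ℤ) (P : Fock n) : Prop := ∀ v : Idx n, N < |mode v| → der v P = 0

theorem exists_bd (P : Fock n) : ∃ N, Bd N P := by
  obtain ⟨Q, rfl⟩ : ∃ Q : PXY n, Q = P := ⟨P, rfl⟩
  obtain ⟨N, hN⟩ := (Q.vars.image fun v => |mode v|).bddAbove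
  refine ⟨N, fun v hv => ?_⟩
  rw [der_apply]
  refine pderiv_eq_zero_of_notMem_vars fun h => ?_
  exact absurd (hN (Finset.mem_coe.2 (Finset.mem_image_of_mem _ h))) (not_le.2 hv)

/-- `f` behaves like an annihilation operator of mode `q`. -/
def IsAnn (f : Module.End ℂ (Fock n)) (q : ℤ) : Prop :=
  ∀ N P, Bd N P → Bd N (f P) ∧ (N < |q| → f P = 0)

theorem isAnn_der (v : Idx n) : IsAnn (der v) (mode v) := fun _ P h =>
  ⟨fun w hw => by
    have := LinearMap.congr_fun (lie_der_der w v) P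
    rw [Ring.lie_def, LinearMap.sub_apply, Module.End.mul_apply, Module.End.mul_apply, h w hw,
      map_zero, sub_zero] at this
    exact this, fun hv => h v hv⟩

theorem IsAnn.smul {f : Module.End ℂ (Fock n)} {q : ℤ} (h : IsAnn f q) (c : ℂ) :
    IsAnn (c • f) q := fun N P hP =>
  ⟨fun v hv => by rw [LinearMap.smul_apply, map_smul, (h N P hP).1 v hv, smul_zero],
    fun hq => by rw [LinearMap.smul_apply, (h N P hP).2 hq, smul_zero]⟩

theorem IsAnn.add {f g : Module.End ℂ (Fock n)} {q : ℤ} (hf : IsAnn f q) (hg : IsAnn g q) :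
    IsAnn (f + g) q := fun N P hP =>
  ⟨fun v hv => by
      rw [LinearMap.add_apply, map_add, (hf N P hP).1 v hv, (hg N P hP).1 v hv, zero_add],
    fun hq => by rw [LinearMap.add_apply, (hf N P hP).2 hq, (hg N P hP).2 hq, zero_add]⟩

theorem isAnn_zero (q : ℤ) : IsAnn (0 : Module.End ℂ (Fock n)) q := fun _ _ _ =>
  ⟨fun _ _ => by simp, fun _ => rfl⟩

theorem IsAnn.neg_mode {f : Module.End ℂ (Fock n)} {q : ℤ} (h : IsAnn f q) : IsAnn f (-q) :=
  fun N P hP => by simpa using h N P hP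

theorem IsAnn.sum {ι : Type*} (s : Finset ι) {f : ι → Module.End ℂ (Fock n)} {q : ℤ}
    (h : ∀ i ∈ s, IsAnn (f i) q) : IsAnn (∑ i ∈ s, f i) q := by
  classical
  induction s using Finset.induction_on with
  | empty => exact isAnn_zero q
  | insert i s hi ih =>
    rw [Finset.sum_insert hi]
    exact (h i (by simp)).add (ih fun j hj => h j (by simp [hj]))

theorem isAnn_aM {u : ℕ × ℕ} {q : ℤ} (h : 0 ≤ q ∧ u.2 + 1 ≤ r) : IsAnn (aM n r u q) q := by
  unfold aM
  split_ifs
  · exact isAnn_der _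
  · exact isAnn_zero q

theorem isAnn_sM {u : ℕ × ℕ} {q : ℤ} (h : ¬(q ≤ 0 ∧ u.2 + 1 ≤ r)) : IsAnn (sM n r u q) q := by
  unfold sM
  split_ifs with hu
  · have := ((isAnn_der (Sum.inl (⟨u.1, hu.1⟩, ⟨u.2, hu.2⟩, -q))).smul (-1)).neg_mode
    simp only [mode, neg_neg, neg_smul, one_smul] at this
    exact this
  · exact isAnn_zero q

theorem isAnn_yM (k : Fin n) {t : ℤ} (h : 0 < t) : IsAnn (yM n k t) t := by
  unfold yM
  rw [dif_pos h]
  have := (isAnn_der (Sum.inr (k, toPos t h))).smul t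
  have e : mode (Sum.inr (k, toPos t h) : Idx n) = t := by
    simp only [mode, toPos, PNat.mk_coe]
    omega
  rwa [e] at this

/-- Normally ordered product of operators tagged with their annihilation flags. -/
noncomputable def nord (l : List (Module.End ℂ (Fock n) × Bool)) : Module.End ℂ (Fock n) :=
  ((l.filter fun p => !p.2).map Prod.fst).prod * ((l.filter fun p => p.2).map Prod.fst).prod

theorem abs_le_of_nord_ne_zero {N : ℤ} {P : Fock n} (hP : Bd N P)
    (L : List ((Module.End ℂ (Fock n) × Bool) × ℤ))
    (hL : ∀ x ∈ L, x.1.2 = true → IsAnn x.1.1 x.2) (h0 : nord (L.map Prod.fst) P ≠ 0) :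
    ∀ x ∈ L, x.1.2 = true → |x.2| ≤ N := by
  have key : ∀ L : List ((Module.End ℂ (Fock n) × Bool) × ℤ),
      (∀ x ∈ L, x.1.2 = true → IsAnn x.1.1 x.2) →
      Bd N ((((L.map Prod.fst).filter fun p => p.2).map Prod.fst).prod P) ∧
      ((((L.map Prod.fst).filter fun p => p.2).map Prod.fst).prod P ≠ 0 →
        ∀ x ∈ L, x.1.2 = true → |x.2| ≤ N) := by
    intro L
    induction L with
    | nil => exact fun _ => ⟨by simpa using hP, by simp⟩
    | cons x L ih =>
      intro h
      obtain ⟨h1, h2⟩ := ih fun y hy => h y (List.mem_cons_of_mem _ hy)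
      by_cases hx : x.1.2 = true
      · have hx' := h x List.mem_cons_self hx
        simp only [List.map_cons, List.filter_cons, hx, if_true, List.prod_cons,
          Module.End.mul_apply, List.forall_mem_cons]
        refine ⟨(hx' N _ h1).1, fun hne => ⟨fun _ => ?_, h2 fun h0 => hne (by rw [h0, map_zero])⟩⟩
        exact le_of_not_gt fun hlt => hne ((hx' N _ h1).2 hlt)
      · simp only [List.map_cons, List.filter_cons, hx, List.forall_mem_cons]
        exact ⟨h1, fun hne => ⟨fun h => absurd h (by simp), h2 hne⟩⟩
  refine (key L hL).2 fun h => h0 ?_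
  rw [nord, Module.End.mul_apply, h, map_zero]

variable (n r)

/-- The oscillator `a` with its annihilation flag. -/
noncomputable def aF (u : ℕ × ℕ) (q : ℤ) : Module.End ℂ (Fock n) × Bool :=
  (aM n r u q, decide (0 ≤ q ∧ u.2 + 1 ≤ r))

/-- The oscillator `a*` with its annihilation flag. -/
noncomputable def sF (u : ℕ × ℕ) (q : ℤ) : Module.End ℂ (Fock n) × Bool :=
  (sM n r u q, !decide (q ≤ 0 ∧ u.2 + 1 ≤ r))

variable {n r}

theorem isAnn_aF {u : ℕ × ℕ} {q : ℤ} (h : (aF n r u q).2 = true) : IsAnn (aF n r u q).1 q :=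
  isAnn_aM (by simpa [aF] using h)

theorem isAnn_sF {u : ℕ × ℕ} {q : ℤ} (h : (sF n r u q).2 = true) : IsAnn (sF n r u q).1 q :=
  isAnn_sM (by simpa only [sF, Bool.not_eq_true', decide_eq_false_iff_not] using h)

theorem nord_pair_of_lie_eq_zero {f g : Module.End ℂ (Fock n)} (h : ⁅f, g⁆ = 0) (a b : Bool) :
    nord [(f, a), (g, b)] = f * g := by
  have h' : g * f = f * g := (sub_eq_zero.1 h).symm
  cases a <;> cases b <;> simp [nord, h']

theorem nord_s_s (u v : ℕ × ℕ) (p q : ℤ) :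
    nord [sF n r u p, sF n r v q] = sM n r u p * sM n r v q :=
  nord_pair_of_lie_eq_zero (lie_s_s _ _ _ _) _ _

theorem lie_a_s_of_ne {u v : ℕ × ℕ} (h : u ≠ v) (p q : ℤ) : ⁅aM n r u p, sM n r v q⁆ = 0 := by
  rw [lie_a_s', if_neg fun h' => h h'.1, zero_smul]

theorem nord_a_s {u v : ℕ × ℕ} (h : u ≠ v) (p q : ℤ) :
    nord [aF n r u p, sF n r v q] = aM n r u p * sM n r v q :=
  nord_pair_of_lie_eq_zero (lie_a_s_of_ne h p q) _ _

theorem nord_s_a (u v : ℕ × ℕ) (p q : ℤ) :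
    nord [sF n r v q, aF n r u p] = nord [aF n r u p, sF n r v q] := by
  by_cases h : ⁅aM n r u p, sM n r v q⁆ = 0
  · have h' : ⁅sM n r v q, aM n r u p⁆ = 0 := by rw [← lie_skew, h, neg_zero]
    rw [aF, sF, nord_pair_of_lie_eq_zero h, nord_pair_of_lie_eq_zero h']
    exact (sub_eq_zero.1 h).symm
  · rw [lie_a_s'] at h
    have h2 : u = v ∧ (u.1 < n ∧ u.2 < n) ∧ p + q = 0 := by
      by_contra hc
      rw [if_neg hc, zero_smul] at h
      exact h rfl
    obtain ⟨rfl, -, hpq⟩ := h2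
    obtain rfl : q = -p := by omega
    have e : (decide (-p ≤ 0 ∧ u.2 + 1 ≤ r)) = decide (0 ≤ p ∧ u.2 + 1 ≤ r) := by
      simp only [neg_nonpos]
    rw [aF, sF, e]
    generalize decide (0 ≤ p ∧ u.2 + 1 ≤ r) = b
    cases b <;> simp [nord]

theorem locFin_of_bound {ι : Type*} {T : ι → Module.End ℂ (Fock n)} (f : ℤ → Set ι)
    (hf : ∀ N, (f N).Finite)
    (h : ∀ N P q, Bd N P → T q P ≠ 0 → q ∈ f N) : LocFin T := fun P => by
  obtain ⟨N, hN⟩ := exists_bd P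
  exact (hf N).subset fun q hq => h N P q hN hq

theorem locFin_quad {f g : ℤ → Module.End ℂ (Fock n) × Bool} (m c : ℤ)
    (hf : ∀ q, (f q).2 = true → IsAnn (f q).1 q) (hg : ∀ q, (g q).2 = true → IsAnn (g q).1 q)
    (h : ∀ N q : ℤ, ((f q).2 = true → |q| ≤ N) → ((g (m - q)).2 = true → |m - q| ≤ N) →
      |q| ≤ |c| + |N|) :
    LocFin fun q => nord [f q, g (m - q)] := by
  refine locFin_of_bound (fun N => Set.Icc (-(|c| + |N|)) (|c| + |N|))
    (fun N => Set.finite_Icc _ _) fun N P q hP h0 => ?_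
  have := abs_le_of_nord_ne_zero hP [(f q, q), (g (m - q), m - q)]
    (by simpa using ⟨hf q, hg (m - q)⟩) (by simpa using h0)
  simp only [List.forall_mem_cons] at this
  exact abs_le.1 (h N q this.1 this.2.1)

theorem locFin_P {u v : ℕ × ℕ} (h : u.2 ≤ v.2) (m : ℤ) :
    LocFin fun q => nord [aF n r u q, sF n r v (m - q)] := by
  refine locFin_quad m m (fun q => isAnn_aF) (fun q => isAnn_sF) fun N q h1 h2 => ?_
  simp only [aF, sF, decide_eq_true_eq, Bool.not_eq_true', decide_eq_false_iff_not] at h1 h2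
  have := le_abs_self m
  have := neg_abs_le m
  have := le_abs_self N
  have := abs_nonneg N
  simp only [abs_le, imp_iff_not_or, not_not] at h1 h2 ⊢
  omega

theorem locFin_SS (u v : ℕ × ℕ) (m : ℤ) :
    LocFin fun q => sM n r u q * sM n r v (m - q) := by
  simp only [← nord_s_s]
  refine locFin_quad m m (fun q => isAnn_sF) (fun q => isAnn_sF) fun N q h1 h2 => ?_
  simp only [sF, Bool.not_eq_true', decide_eq_false_iff_not] at h1 h2
  have := le_abs_self m
  have := neg_abs_le m
  have := le_abs_self N
  have := abs_nonneg N
  simp only [abs_le, imp_iff_not_or, not_not] at h1 h2 ⊢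
  omega

theorem locFin_C {u v : ℕ × ℕ} (h : u.2 ≤ v.2) (m : ℤ) :
    LocFin fun q : ℤ × ℤ => nord [sF n r v q.1, aF n r u q.2, sF n r u (m - q.1 - q.2)] := by
  refine locFin_of_bound (fun N => Set.Icc (-(|m| + 2 * |N|)) (|m| + 2 * |N|) ×ˢ
      Set.Icc (-(|m| + 2 * |N|)) (|m| + 2 * |N|))
    (fun N => (Set.finite_Icc _ _).prod (Set.finite_Icc _ _)) fun N P q hP h0 => ?_
  have := abs_le_of_nord_ne_zero hP
    [(sF n r v q.1, q.1), (aF n r u q.2, q.2), (sF n r u (m - q.1 - q.2), m - q.1 - q.2)]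
    (by simpa using ⟨isAnn_sF, isAnn_aF, isAnn_sF⟩) (by simpa using h0)
  simp only [List.forall_mem_cons, aF, sF, decide_eq_true_eq, Bool.not_eq_true',
    decide_eq_false_iff_not] at this
  obtain ⟨h1, h2, h3, -⟩ := this
  have := le_abs_self m
  have := neg_abs_le m
  have := le_abs_self N
  have := abs_nonneg N
  simp only [abs_le, imp_iff_not_or, not_not] at h1 h2 h3
  simp only [Set.mem_prod, Set.mem_Icc]
  omega

variable (n) in
/-- The Heisenberg operator with natural number index. -/
noncomputable def bM (e : ℕ → Fin n → ℂ) (lam : ℕ → ℂ) (i : ℕ) (m : ℤ) : Module.End ℂ (Fock n) :=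
  (if m = 0 then lam i else 0) • 1 + ∑ k, e i k • yM n k m

variable (e : ℕ → Fin n → ℂ) (lam : ℕ → ℂ)

theorem lie_s_b (u : ℕ × ℕ) (i : ℕ) (p q : ℤ) : ⁅sM n r u p, bM n e lam i q⁆ = 0 := by
  simp only [bM, lie_add, lie_sum, lie_smul, lie_s_y]
  simp [Ring.lie_def]

theorem lie_a_b (u : ℕ × ℕ) (i : ℕ) (p q : ℤ) : ⁅aM n r u p, bM n e lam i q⁆ = 0 := by
  simp only [bM, lie_add, lie_sum, lie_smul, lie_a_y]
  simp [Ring.lie_def]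

theorem lie_b_y (i : ℕ) (k : Fin n) (p q : ℤ) : ⁅bM n e lam i p, yM n k q⁆ =
    (if p + q = 0 then (p : ℂ) * e i k else 0) • 1 := by
  have : ⁅(1 : Module.End ℂ (Fock n)), yM n k q⁆ = 0 := by simp [Ring.lie_def]
  simp only [bM, add_lie, sum_lie, smul_lie, lie_y_y, this, smul_zero, zero_add, smul_smul,
    ← Finset.sum_smul]
  congr 1
  rw [Finset.sum_eq_single k (by simp +contextual) (by simp)]
  split_ifs <;> simp_all [mul_comm]

theorem lie_b_b (i j : ℕ) (p q : ℤ) : ⁅bM n e lam i p, bM n e lam j q⁆ =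
    (if p + q = 0 then (p : ℂ) * ∑ k, e i k * e j k else 0) • 1 := by
  have : ⁅bM n e lam i p, (1 : Module.End ℂ (Fock n))⁆ = 0 := by simp [Ring.lie_def]
  rw [show bM n e lam j q = (if q = 0 then lam j else 0) • 1 + ∑ k, e j k • yM n k q from rfl,
    lie_add, lie_smul, this, smul_zero, zero_add, lie_sum]
  simp only [lie_smul, lie_b_y, smul_smul, ← Finset.sum_smul]
  congr 1
  split_ifs
  · rw [Finset.mul_sum]
    exact Finset.sum_congr rfl fun k _ => by ring
  · simp

theorem locFin_B (u : ℕ × ℕ) (i : ℕ) (m : ℤ) :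
    LocFin fun q => sM n r u q * bM n e lam i (m - q) := by
  have : (fun q => sM n r u q * bM n e lam i (m - q)) = fun q =>
      nord [sF n r u q, (bM n e lam i (m - q), decide (0 < m - q))] := by
    funext q
    exact (nord_pair_of_lie_eq_zero (lie_s_b e lam _ _ _ _) _ _).symm
  rw [this]
  refine locFin_quad (g := fun q => (bM n e lam i q, decide (0 < q))) m m (fun q => isAnn_sF)
    (fun q hq => ?_) fun N q h1 h2 => ?_
  · have hq : 0 < q := by simpa using hq
    rw [bM, if_neg hq.ne', zero_smul, zero_add]
    exact IsAnn.sum _ fun k _ => (isAnn_yM k hq).smul _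
  simp only [sF, decide_eq_true_eq, Bool.not_eq_true', decide_eq_false_iff_not] at h1 h2
  have := le_abs_self m
  have := neg_abs_le m
  have := le_abs_self N
  have := abs_nonneg N
  simp only [abs_le, imp_iff_not_or, not_not] at h1 h2 ⊢
  omega

end LocalFiniteness

section Composites

variable {n r : ℕ}

theorem mul_lie_eq {V : Type*} [AddCommGroup V] [Module ℂ V] (f g φ : Module.End ℂ V) :
    ⁅f * g, φ⁆ = f * ⁅g, φ⁆ + ⁅f, φ⁆ * g := by
  simp only [Ring.lie_def, mul_sub, sub_mul, mul_assoc]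
  abel

theorem lie_mul_eq {V : Type*} [AddCommGroup V] [Module ℂ V] (φ f g : Module.End ℂ V) :
    ⁅φ, f * g⁆ = ⁅φ, f⁆ * g + f * ⁅φ, g⁆ := by
  simp only [Ring.lie_def, mul_sub, sub_mul, mul_assoc]
  abel

theorem nord_pair_lie {f g φ : Module.End ℂ (Fock n)} {c d : ℂ} (hf : ⁅f, φ⁆ = c • 1)
    (hg : ⁅g, φ⁆ = d • 1) (a b : Bool) : ⁅nord [(f, a), (g, b)], φ⁆ = d • f + c • g := by
  cases a <;> cases b <;> simp [nord, mul_lie_eq, hf, hg, add_comm]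

theorem nord_triple_lie {f g h φ : Module.End ℂ (Fock n)} {c d k : ℂ} (hf : ⁅f, φ⁆ = c • 1)
    (hg : ⁅g, φ⁆ = d • 1) (hh : ⁅h, φ⁆ = k • 1) (x y z : Bool) :
    ⁅nord [(f, x), (g, y), (h, z)], φ⁆ =
      c • nord [(g, y), (h, z)] + d • nord [(f, x), (h, z)] + k • nord [(f, x), (g, y)] := by
  cases x <;> cases y <;> cases z <;>
    simp [nord, mul_lie_eq, hf, hg, hh, mul_add, mul_assoc] <;> abel

theorem lie_nord_pair {T f g f' g' : Module.End ℂ (Fock n)} (hf : ⁅T, f⁆ = f') (hg : ⁅T, g⁆ = g')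
    (h1 : ⁅f', g⁆ = 0) (h2 : ⁅f, g'⁆ = 0) (x y : Bool) :
    ⁅T, nord [(f, x), (g, y)]⁆ = f' * g + f * g' := by
  have e1 : g * f' = f' * g := (sub_eq_zero.1 h1).symm
  have e2 : g' * f = f * g' := (sub_eq_zero.1 h2).symm
  cases x <;> cases y <;> simp [nord, lie_mul_eq, hf, hg, e1, e2, add_comm]

theorem lie_nord_triple_of_eigen {T f g h : Module.End ℂ (Fock n)} {c d k : ℂ}
    (hf : ⁅T, f⁆ = c • f) (hg : ⁅T, g⁆ = d • g) (hh : ⁅T, h⁆ = k • h) (x y z : Bool) :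
    ⁅T, nord [(f, x), (g, y), (h, z)]⁆ = (c + d + k) • nord [(f, x), (g, y), (h, z)] := by
  cases x <;> cases y <;> cases z <;>
    simp [nord, lie_mul_eq, hf, hg, hh, add_smul, mul_add, mul_assoc] <;> abel

variable (n r)

/-- The modes of `:a_u(z) a*_v(z):`. -/
noncomputable def PM (u v : ℕ × ℕ) (m : ℤ) : Module.End ℂ (Fock n) :=
  LSum fun q => nord [aF n r u q, sF n r v (m - q)]

/-- The modes of `a*_u(z) a*_v(z)`. -/
noncomputable def SSM (u v : ℕ × ℕ) (m : ℤ) : Module.End ℂ (Fock n) :=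
  LSum fun q => sM n r u q * sM n r v (m - q)

/-- The modes of `:a*_v(z) a_u(z) a*_u(z):`. -/
noncomputable def CM (v u : ℕ × ℕ) (m : ℤ) : Module.End ℂ (Fock n) :=
  LSum fun q : ℤ × ℤ => nord [sF n r v q.1, aF n r u q.2, sF n r u (m - q.1 - q.2)]

/-- The modes of `a*_u(z) b_i(z)`. -/
noncomputable def BM (e : ℕ → Fin n → ℂ) (lam : ℕ → ℂ) (u : ℕ × ℕ) (i : ℕ) (m : ℤ) :
    Module.End ℂ (Fock n) :=
  LSum fun q => sM n r u q * bM n e lam i (m - q)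

variable {n r}

theorem LSum_smul_single (c : ℂ) (p : Prop) [Decidable p] (m t s : ℤ) (hs : s = m + t)
    (f : ℤ → Module.End ℂ (Fock n)) :
    LSum (fun q => (if p ∧ m - q + t = 0 then c else 0) • f q) = if p then c • f s else 0 := by
  rw [LSum_single s fun q hq => by rw [if_neg (by omega), zero_smul]]
  by_cases hp : p
  · rw [if_pos hp, if_pos ⟨hp, by omega⟩]
  · rw [if_neg hp, if_neg (by tauto), zero_smul]

theorem LSum_smul_single' (c : ℂ) (p : Prop) [Decidable p] (t s : ℤ) (hs : s = - t)
    (f : ℤ → Module.End ℂ (Fock n)) :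
    LSum (fun q => (if p ∧ q + t = 0 then c else 0) • f q) = if p then c • f s else 0 := by
  rw [LSum_single s fun q hq => by rw [if_neg (by omega), zero_smul]]
  by_cases hp : p
  · rw [if_pos hp, if_pos ⟨hp, by omega⟩]
  · rw [if_neg hp, if_neg (by tauto), zero_smul]

theorem lie_P_a {u v w : ℕ × ℕ} (h : u.2 ≤ v.2) (hw : w.1 < n ∧ w.2 < n) (m t : ℤ) :
    ⁅PM n r u v m, aM n r w t⁆ = if w = v then -aM n r u (m + t) else 0 := by
  have key (q : ℤ) : ⁅nord [aF n r u q, sF n r v (m - q)], aM n r w t⁆ =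
      (if w = v ∧ m - q + t = 0 then (-1 : ℂ) else 0) • aM n r u q := by
    rw [aF, sF, nord_pair_lie (c := 0) (by rw [lie_a_a, zero_smul]) (lie_s_a _ _ hw _ _), zero_smul,
      add_zero]
  rw [PM, LSum_lie (locFin_P h m)]
  simp only [key]
  rw [LSum_smul_single _ _ _ _ _ rfl, neg_one_smul]

theorem lie_P_s {u v w : ℕ × ℕ} (h : u.2 ≤ v.2) (hw : w.1 < n ∧ w.2 < n) (m t : ℤ) :
    ⁅PM n r u v m, sM n r w t⁆ = if u = w then sM n r v (m + t) else 0 := by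
  have key (q : ℤ) : ⁅nord [aF n r u q, sF n r v (m - q)], sM n r w t⁆ =
      (if u = w ∧ q + t = 0 then (1 : ℂ) else 0) • sM n r v (m - q) := by
    rw [aF, sF, nord_pair_lie (d := 0) (lie_a_s _ _ hw _ _) (by rw [lie_s_s, zero_smul]), zero_smul,
      zero_add]
  rw [PM, LSum_lie (locFin_P h m)]
  simp only [key]
  rw [LSum_smul_single' _ _ _ _ rfl fun q => sM n r v (m - q), one_smul, sub_neg_eq_add]

theorem lie_P_y {u v : ℕ × ℕ} (h : u.2 ≤ v.2) (k : Fin n) (m t : ℤ) :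
    ⁅PM n r u v m, yM n k t⁆ = 0 := by
  have key (q : ℤ) : ⁅nord [aF n r u q, sF n r v (m - q)], yM n k t⁆ = 0 := by
    rw [aF, sF, nord_pair_lie (c := 0) (d := 0) (by rw [lie_a_y, zero_smul])
      (by rw [lie_s_y, zero_smul]), zero_smul, zero_smul, add_zero]
  rw [PM, LSum_lie (locFin_P h m)]
  simp only [key, LSum_zero]

theorem lie_P_b {u v : ℕ × ℕ} (h : u.2 ≤ v.2) (e : ℕ → Fin n → ℂ) (lam : ℕ → ℂ) (i : ℕ) (m t : ℤ) :
    ⁅PM n r u v m, bM n e lam i t⁆ = 0 := by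
  have key (q : ℤ) : ⁅nord [aF n r u q, sF n r v (m - q)], bM n e lam i t⁆ = 0 := by
    rw [aF, sF, nord_pair_lie (c := 0) (d := 0) (by rw [lie_a_b, zero_smul])
      (by rw [lie_s_b, zero_smul]), zero_smul, zero_smul, add_zero]
  rw [PM, LSum_lie (locFin_P h m)]
  simp only [key, LSum_zero]

theorem lie_C_s {v u w : ℕ × ℕ} (h : u.2 ≤ v.2) (hw : w.1 < n ∧ w.2 < n) (m t : ℤ) :
    ⁅CM n r v u m, sM n r w t⁆ = if u = w then SSM n r v u (m + t) else 0 := by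
  have key (q : ℤ × ℤ) :
      ⁅nord [sF n r v q.1, aF n r u q.2, sF n r u (m - q.1 - q.2)], sM n r w t⁆ =
      (if u = w ∧ q.2 + t = 0 then (1 : ℂ) else 0) •
        (sM n r v q.1 * sM n r u (m - q.1 - q.2)) := by
    rw [← nord_s_s, aF, sF, sF, nord_triple_lie (c := 0) (k := 0) (by rw [lie_s_s, zero_smul])
      (lie_a_s _ _ hw _ _) (by rw [lie_s_s, zero_smul]), zero_smul, zero_smul, zero_add, add_zero]
  rw [CM, LSum_lie (locFin_C h m)]
  simp only [key]
  by_cases huw : u = w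
  · rw [if_pos huw, SSM, ← LSum_comp (f := fun q : ℤ => (q, -t)) (fun q q' hq => by simpa using hq)
      fun q hq => ?_]
    · congr 1
      funext q
      rw [if_pos ⟨huw, by simp⟩, one_smul]
      congr 2
      ring
    · rw [if_neg, zero_smul]
      rintro ⟨-, h0⟩
      exact hq ⟨q.1, Prod.ext rfl (by simp only; omega)⟩
  · simp only [huw, false_and, if_false, zero_smul, LSum_zero]

theorem lie_C_y {v u : ℕ × ℕ} (h : u.2 ≤ v.2) (k : Fin n) (m t : ℤ) :
    ⁅CM n r v u m, yM n k t⁆ = 0 := by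
  have key (q : ℤ × ℤ) :
      ⁅nord [sF n r v q.1, aF n r u q.2, sF n r u (m - q.1 - q.2)], yM n k t⁆ = 0 := by
    rw [aF, sF, sF, nord_triple_lie (c := 0) (d := 0) (k := 0) (by rw [lie_s_y, zero_smul])
      (by rw [lie_a_y, zero_smul]) (by rw [lie_s_y, zero_smul]), zero_smul, zero_smul, zero_smul,
      zero_add, zero_add]
  rw [CM, LSum_lie (locFin_C h m)]
  simp only [key, LSum_zero]

theorem locFin_slice {f : ℤ → Module.End ℂ (Fock n)} (hf : LocFin f) (p : Prop) [Decidable p]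
    (g : ℤ → ℤ × ℤ) (hg : Function.Injective g) (k : ℤ × ℤ → ℤ) (hk : ∀ q, k (g q) = q)
    (c : ℤ × ℤ → Prop) [DecidablePred c] (hc : ∀ q, c q ↔ q ∈ Set.range g) :
    LocFin (fun q => (if p ∧ c q then (-1 : ℂ) else 0) • f (k q)) ∧
      LSum (fun q => (if p ∧ c q then (-1 : ℂ) else 0) • f (k q)) = if p then -LSum f else 0 := by
  by_cases hp : p
  · simp only [hp, true_and, if_true]
    have h0 : ∀ q, q ∉ Set.range g → (if c q then (-1 : ℂ) else 0) • f (k q) = 0 := fun q hq => by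
      rw [if_neg fun h => hq ((hc q).1 h), zero_smul]
    have e : (fun q => (if c (g q) then (-1 : ℂ) else 0) • f (k (g q))) = fun q => -f q := by
      funext q
      rw [if_pos ((hc _).2 ⟨q, rfl⟩), hk, neg_one_smul]
    refine ⟨(locFin_comp_iff hg h0).1 ?_, ?_⟩
    · rw [e]
      exact hf.neg
    · rw [← LSum_comp hg h0, e, LSum_neg hf]
  · simp only [hp, false_and, if_false, zero_smul, LSum_zero]
    exact ⟨locFin_zero, trivial⟩

theorem lie_C_a {v u w : ℕ × ℕ} (h : u.2 ≤ v.2) (hw : w.1 < n ∧ w.2 < n) (m t : ℤ) :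
    ⁅CM n r v u m, aM n r w t⁆ = (if w = v then -PM n r u u (m + t) else 0) +
      if w = u then -PM n r u v (m + t) else 0 := by
  have key (q : ℤ × ℤ) :
      ⁅nord [sF n r v q.1, aF n r u q.2, sF n r u (m - q.1 - q.2)], aM n r w t⁆ =
      (if w = v ∧ q.1 + t = 0 then (-1 : ℂ) else 0) •
        nord [aF n r u q.2, sF n r u (m + t - q.2)] +
      (if w = u ∧ m - q.1 - q.2 + t = 0 then (-1 : ℂ) else 0) •
        nord [aF n r u q.2, sF n r v (m + t - q.2)] := by
    have e := nord_triple_lie (g := aM n r u q.2) (d := 0) (lie_s_a v w hw q.1 t)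
      (by rw [lie_a_a, zero_smul])
      (lie_s_a u w hw (m - q.1 - q.2) t) (sF n r v q.1).2 (aF n r u q.2).2
      (sF n r u (m - q.1 - q.2)).2
    refine e.trans ?_
    rw [zero_smul, add_zero]
    congr 1
    · by_cases hc : w = v ∧ q.1 + t = 0
      · rw [show m - q.1 - q.2 = m + t - q.2 by omega]
        rfl
      · rw [if_neg hc, zero_smul, zero_smul]
    · by_cases hc : w = u ∧ m - q.1 - q.2 + t = 0
      · rw [show m + t - q.2 = q.1 by omega, ← nord_s_a]
        rfl
      · rw [if_neg hc, zero_smul, zero_smul]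
  rw [CM, LSum_lie (locFin_C h m)]
  simp only [key]
  have h1 := locFin_slice (locFin_P (n := n) (r := r) (le_refl u.2) (m + t)) (w = v)
    (fun q => (-t, q)) (fun q q' hq => by simpa using hq) Prod.snd (fun q => rfl)
    (fun q => q.1 + t = 0) fun q => ⟨fun h => ⟨q.2, Prod.ext (by simp only; omega) rfl⟩, by
      rintro ⟨q, rfl⟩
      simp⟩
  have h2 := locFin_slice (locFin_P (n := n) (r := r) h (m + t)) (w = u)
    (fun q => (m + t - q, q)) (fun q q' hq => by simpa using congrArg Prod.snd hq)
    Prod.snd (fun q => rfl)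
    (fun q => m - q.1 - q.2 + t = 0) fun q =>
      ⟨fun h => ⟨q.2, Prod.ext (by simp only; omega) rfl⟩, by
        rintro ⟨q, rfl⟩
        ring⟩
  rw [LSum_add h1.1 h2.1, h1.2, h2.2]
  rfl

variable (e : ℕ → Fin n → ℂ) (lam : ℕ → ℂ)

theorem lie_b_s (u : ℕ × ℕ) (i : ℕ) (p q : ℤ) : ⁅bM n e lam i p, sM n r u q⁆ = 0 := by
  rw [← lie_skew, lie_s_b, neg_zero]

theorem lie_b_a (u : ℕ × ℕ) (i : ℕ) (p q : ℤ) : ⁅bM n e lam i p, aM n r u q⁆ = 0 := by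
  rw [← lie_skew, lie_a_b, neg_zero]

theorem lie_B_s (u w : ℕ × ℕ) (i : ℕ) (m t : ℤ) : ⁅BM n r e lam u i m, sM n r w t⁆ = 0 := by
  rw [BM, LSum_lie (locFin_B e lam u i m)]
  simp only [mul_lie_eq, lie_s_s, lie_b_s, mul_zero, zero_mul, add_zero, LSum_zero]

theorem lie_B_a {u w : ℕ × ℕ} (hw : w.1 < n ∧ w.2 < n) (i : ℕ) (m t : ℤ) :
    ⁅BM n r e lam u i m, aM n r w t⁆ = if w = u then -bM n e lam i (m + t) else 0 := by
  rw [BM, LSum_lie (locFin_B e lam u i m)]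
  simp only [mul_lie_eq, lie_s_a _ _ hw, lie_b_a, mul_zero, zero_add, smul_mul_assoc, one_mul]
  rw [LSum_smul_single' _ _ _ _ rfl fun q => bM n e lam i (m - q), neg_one_smul, sub_neg_eq_add]

theorem lie_B_y (u : ℕ × ℕ) (i : ℕ) (k : Fin n) (m t : ℤ) :
    ⁅BM n r e lam u i m, yM n k t⁆ = (-(t * e i k)) • sM n r u (m + t) := by
  rw [BM, LSum_lie (locFin_B e lam u i m)]
  simp only [mul_lie_eq, lie_s_y, lie_b_y, zero_mul, add_zero, mul_smul_comm, mul_one]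
  rw [LSum_single (m + t) fun q hq => by rw [if_neg (by omega), zero_smul], if_pos (by omega)]
  congr 1
  push_cast
  ring

end Composites

section ChevalleyGenerators

variable (n r : ℕ) (γ : ℂ) (e : ℕ → Fin n → ℂ) (lam : ℕ → ℂ)

/-- The coefficient of `-∂a*_{ii}(z)` in `E_i(z)`. -/
noncomputable def kap (r : ℕ) (γ : ℂ) (i : ℕ) : ℂ :=
  (if r < i + 1 then (r : ℂ) + 1 else 0) + (if i + 1 ≤ r then (i : ℂ) + 2 else 0) - γ ^ 2

/-- The modes of `E_i(z)`. -/
noncomputable def EM (i : ℕ) (m : ℤ) : Module.End ℂ (Fock n) :=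
  ∑ k ∈ Finset.range i, CM n r (i, i) (k, i - 1) m
  - ∑ k ∈ Finset.range (i + 1), CM n r (i, i) (k, i) m
  + ∑ l ∈ Finset.Ico (i + 1) n, PM n r (i + 1, l) (i, l) m
  - ∑ k ∈ Finset.range i, PM n r (k, i - 1) (k, i) m
  - BM n r e lam (i, i) i m
  + (kap r γ i * m) • sM n r (i, i) m

/-- The modes of `F_i(z)`. -/
noncomputable def FM (i : ℕ) (m : ℤ) : Module.End ℂ (Fock n) :=
  aM n r (i, i) m + ∑ l ∈ Finset.Ico (i + 1) n, PM n r (i, l) (i + 1, l) m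

/-- A weighted sum of the modes of the currents `:a_u(z) a*_u(z):`. -/
noncomputable def DM (wt : ℕ × ℕ → ℤ) (m : ℤ) : Module.End ℂ (Fock n) :=
  ∑ u ∈ Finset.range n ×ˢ Finset.range n, (wt u : ℂ) • PM n r u u m

/-- The pairing of the simple root `α_i` with the positive root `α_k + ⋯ + α_l`. -/
def pr (i : ℕ) (u : ℕ × ℕ) : ℤ :=
  if u.1 ≤ u.2 then
    (if i = u.1 then 1 else 0) + (if i = u.2 then 1 else 0) - (if i + 1 = u.1 then 1 else 0)
      - (if i = u.2 + 1 then 1 else 0)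
  else 0

/-- The modes of `H_i(z)`. -/
noncomputable def HM (i : ℕ) (m : ℤ) : Module.End ℂ (Fock n) :=
  DM n r (pr i) m + bM n e lam i m

/-- The current appearing in the bracket of `E_j(z)` with `a_{jj}(w)`. -/
noncomputable def HtM (j : ℕ) (m : ℤ) : Module.End ℂ (Fock n) :=
  -∑ k ∈ Finset.range j, PM n r (k, j - 1) (k, j - 1) m
  + ∑ k ∈ Finset.range (j + 1), PM n r (k, j) (k, j) m
  + PM n r (j, j) (j, j) m + bM n e lam j m

variable {n r}

theorem sum_ite_fst {V : Type*} [AddCommMonoid V] (S : Finset ℕ) (f : ℕ → V) (j k l : ℕ) :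
    (∑ x ∈ S, if (x, j) = (k, l) then f x else 0) = if k ∈ S ∧ j = l then f k else 0 := by
  by_cases h : j = l <;> simp [h]

theorem sum_ite_snd {V : Type*} [AddCommMonoid V] (S : Finset ℕ) (f : ℕ → V) (j k l : ℕ) :
    (∑ x ∈ S, if (j, x) = (k, l) then f x else 0) = if l ∈ S ∧ j = k then f l else 0 := by
  by_cases h : j = k <;> simp [h]

theorem sum_ite_fst' {V : Type*} [AddCommMonoid V] (S : Finset ℕ) (f : ℕ → V) (j k l : ℕ) :
    (∑ x ∈ S, if (k, l) = (x, j) then f x else 0) = if k ∈ S ∧ j = l then f k else 0 := by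
  simp only [← sum_ite_fst, eq_comm]

theorem sum_ite_snd' {V : Type*} [AddCommMonoid V] (S : Finset ℕ) (f : ℕ → V) (j k l : ℕ) :
    (∑ x ∈ S, if (k, l) = (j, x) then f x else 0) = if l ∈ S ∧ j = k then f l else 0 := by
  simp only [← sum_ite_snd, eq_comm]

theorem lie_E_s {i k l : ℕ} (hk : k < n) (hl : l < n) (m t : ℤ) :
    ⁅EM n r γ e lam i m, sM n r (k, l) t⁆ =
      (if k < i ∧ i - 1 = l then SSM n r (i, i) (k, i - 1) (m + t) - sM n r (k, i) (m + t) else 0)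
      - (if k < i + 1 ∧ i = l then SSM n r (i, i) (k, i) (m + t) else 0)
      + if (i + 1 ≤ l ∧ l < n) ∧ i + 1 = k then sM n r (i, l) (m + t) else 0 := by
  have hw : ((k, l) : ℕ × ℕ).1 < n ∧ ((k, l) : ℕ × ℕ).2 < n := ⟨hk, hl⟩
  have h1 (x : ℕ) := lie_C_s (n := n) (r := r) (v := (i, i)) (u := (x, i - 1)) (by simp) hw m t
  have h2 (x : ℕ) := lie_C_s (n := n) (r := r) (v := (i, i)) (u := (x, i)) (by simp) hw m t
  have h3 (x : ℕ) := lie_P_s (n := n) (r := r) (u := (i + 1, x)) (v := (i, x)) (by simp) hw m t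
  have h4 (x : ℕ) := lie_P_s (n := n) (r := r) (u := (x, i - 1)) (v := (x, i)) (by simp) hw m t
  simp only [EM, add_lie, sub_lie, sum_lie, smul_lie, h1, h2, h3, h4, lie_B_s, lie_s_s, smul_zero,
    sum_ite_fst, sum_ite_snd, Finset.mem_range, Finset.mem_Ico]
  split_ifs <;> abel

theorem lie_E_a {i k l : ℕ} (hk : k < n) (hl : l < n) (m t : ℤ) :
    ⁅EM n r γ e lam i m, aM n r (k, l) t⁆ =
      (if k < i ∧ i - 1 = l then -PM n r (k, i - 1) (i, i) (m + t) else 0)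
      + (if k < i ∧ i = l then aM n r (k, i - 1) (m + t) + PM n r (k, i) (i, i) (m + t) else 0)
      + (if (i + 1 ≤ l ∧ l < n) ∧ i = k then -aM n r (i + 1, l) (m + t) else 0)
      + if i = k ∧ i = l then HtM n r e lam i (m + t)
          - (if m + t = 0 then kap r γ i * m else 0) • 1 else 0 := by
  have hw : ((k, l) : ℕ × ℕ).1 < n ∧ ((k, l) : ℕ × ℕ).2 < n := ⟨hk, hl⟩
  have h1 (x : ℕ) := lie_C_a (n := n) (r := r) (v := (i, i)) (u := (x, i - 1)) (by simp) hw m t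
  have h2 (x : ℕ) := lie_C_a (n := n) (r := r) (v := (i, i)) (u := (x, i)) (by simp) hw m t
  have h3 (x : ℕ) := lie_P_a (n := n) (r := r) (u := (i + 1, x)) (v := (i, x)) (by simp) hw m t
  have h4 (x : ℕ) := lie_P_a (n := n) (r := r) (u := (x, i - 1)) (v := (x, i)) (by simp) hw m t
  have h5 := lie_s_a (n := n) (r := r) (i, i) (k, l) hw m t
  simp only [EM, add_lie, sub_lie, sum_lie, smul_lie, h1, h2, h3, h4, h5, lie_B_a _ _ hw,
    Finset.sum_add_distrib, sum_ite_fst', sum_ite_snd', Finset.mem_range, Finset.mem_Ico]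
  by_cases hd : i = k ∧ i = l
  · obtain ⟨rfl, rfl⟩ := hd
    have e1 : ¬(i + 1 ≤ i) := by omega
    simp only [lt_irrefl, e1, false_and, if_false, and_self, if_true, lt_add_one, true_and, HtM,
      Finset.sum_neg_distrib]
    split_ifs <;> simp <;> module
  · have hd' : ¬((k, l) = (i, i)) := by
      simp only [Prod.mk.injEq]
      omega
    simp only [hd, hd', false_and, if_false, Finset.sum_const_zero, zero_smul, smul_zero]
    split_ifs <;> first | omega | abel

theorem lie_E_y (i : ℕ) (k : Fin n) (m t : ℤ) :
    ⁅EM n r γ e lam i m, yM n k t⁆ = (t * e i k) • sM n r (i, i) (m + t) := by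
  have h1 (x : ℕ) := lie_C_y (n := n) (r := r) (v := (i, i)) (u := (x, i - 1)) (by simp) k m t
  have h2 (x : ℕ) := lie_C_y (n := n) (r := r) (v := (i, i)) (u := (x, i)) (by simp) k m t
  have h3 (x : ℕ) := lie_P_y (n := n) (r := r) (u := (i + 1, x)) (v := (i, x)) (by simp) k m t
  have h4 (x : ℕ) := lie_P_y (n := n) (r := r) (u := (x, i - 1)) (v := (x, i)) (by simp) k m t
  simp only [EM, add_lie, sub_lie, sum_lie, smul_lie, h1, h2, h3, h4, lie_B_y, lie_s_y, smul_zero,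
    Finset.sum_const_zero, neg_smul]
  abel

theorem lie_F_s {i k l : ℕ} (hk : k < n) (hl : l < n) (m t : ℤ) :
    ⁅FM n r i m, sM n r (k, l) t⁆ = (if (i = k ∧ i = l) ∧ m + t = 0 then (1 : ℂ) else 0) • 1
      + if (i + 1 ≤ l ∧ l < n) ∧ i = k then sM n r (i + 1, l) (m + t) else 0 := by
  have hw : ((k, l) : ℕ × ℕ).1 < n ∧ ((k, l) : ℕ × ℕ).2 < n := ⟨hk, hl⟩
  have h1 (x : ℕ) := lie_P_s (n := n) (r := r) (u := (i, x)) (v := (i + 1, x)) (by simp) hw m t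
  simp only [FM, add_lie, sum_lie, h1, sum_ite_snd, lie_a_s _ _ hw, Finset.mem_Ico]
  simp only [Prod.mk.injEq]

theorem lie_F_a {i k l : ℕ} (hk : k < n) (hl : l < n) (m t : ℤ) :
    ⁅FM n r i m, aM n r (k, l) t⁆ =
      if (i + 1 ≤ l ∧ l < n) ∧ i + 1 = k then -aM n r (i, l) (m + t) else 0 := by
  have hw : ((k, l) : ℕ × ℕ).1 < n ∧ ((k, l) : ℕ × ℕ).2 < n := ⟨hk, hl⟩
  have h1 (x : ℕ) := lie_P_a (n := n) (r := r) (u := (i, x)) (v := (i + 1, x)) (by simp) hw m t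
  simp only [FM, add_lie, sum_lie, h1, sum_ite_snd', lie_a_a, zero_add,
    Finset.mem_Ico]

theorem lie_F_y (i : ℕ) (k : Fin n) (m t : ℤ) : ⁅FM n r i m, yM n k t⁆ = 0 := by
  have h1 (x : ℕ) := lie_P_y (n := n) (r := r) (u := (i, x)) (v := (i + 1, x)) (by simp) k m t
  simp only [FM, add_lie, sum_lie, h1, lie_a_y, Finset.sum_const_zero, add_zero]

theorem lie_F_b (i j : ℕ) (m t : ℤ) : ⁅FM n r i m, bM n e lam j t⁆ = 0 := by
  have h1 (x : ℕ) := lie_P_b (n := n) (r := r) (u := (i, x)) (v := (i + 1, x)) (by simp) e lam j m t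
  simp only [FM, add_lie, sum_lie, h1, lie_a_b, Finset.sum_const_zero, add_zero]

theorem lie_D_s (wt : ℕ × ℕ → ℤ) {w : ℕ × ℕ} (hw : w.1 < n ∧ w.2 < n) (m t : ℤ) :
    ⁅DM n r wt m, sM n r w t⁆ = (wt w : ℂ) • sM n r w (m + t) := by
  simp only [DM, sum_lie, smul_lie, lie_P_s (le_refl _) hw, smul_ite, smul_zero,
    Finset.sum_ite_eq']
  rw [if_pos (by simpa using hw)]

theorem lie_D_a (wt : ℕ × ℕ → ℤ) {w : ℕ × ℕ} (hw : w.1 < n ∧ w.2 < n) (m t : ℤ) :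
    ⁅DM n r wt m, aM n r w t⁆ = (-wt w : ℂ) • aM n r w (m + t) := by
  simp only [DM, sum_lie, smul_lie, lie_P_a (le_refl _) hw, smul_ite, smul_zero,
    Finset.sum_ite_eq]
  rw [if_pos (by simpa using hw), smul_neg, neg_smul]

theorem lie_D_y (wt : ℕ × ℕ → ℤ) (k : Fin n) (m t : ℤ) : ⁅DM n r wt m, yM n k t⁆ = 0 := by
  simp only [DM, sum_lie, smul_lie, lie_P_y (le_refl _), smul_zero, Finset.sum_const_zero]

theorem lie_D_b (wt : ℕ × ℕ → ℤ) (i : ℕ) (m t : ℤ) : ⁅DM n r wt m, bM n e lam i t⁆ = 0 := by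
  simp only [DM, sum_lie, smul_lie, lie_P_b (le_refl _), smul_zero, Finset.sum_const_zero]

theorem lie_H_s (i : ℕ) {w : ℕ × ℕ} (hw : w.1 < n ∧ w.2 < n) (m t : ℤ) :
    ⁅HM n r e lam i m, sM n r w t⁆ = (pr i w : ℂ) • sM n r w (m + t) := by
  rw [HM, add_lie, lie_D_s _ hw, lie_b_s, add_zero]

theorem lie_H_a (i : ℕ) {w : ℕ × ℕ} (hw : w.1 < n ∧ w.2 < n) (m t : ℤ) :
    ⁅HM n r e lam i m, aM n r w t⁆ = (-pr i w : ℂ) • aM n r w (m + t) := by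
  rw [HM, add_lie, lie_D_a _ hw, lie_b_a, add_zero]

theorem lie_H_y (i : ℕ) (k : Fin n) (m t : ℤ) : ⁅HM n r e lam i m, yM n k t⁆ =
    (if m + t = 0 then (m : ℂ) * e i k else 0) • 1 := by
  rw [HM, add_lie, lie_D_y, lie_b_y, zero_add]

end ChevalleyGenerators

section QuadraticBrackets

variable {n r : ℕ}

theorem LSum_shift {V : Type*} [AddCommGroup V] [Module ℂ V] (T : ℤ → Module.End ℂ V) (d : ℤ) :
    LSum (fun q => T (d + q)) = LSum T :=
  LSum_comp (f := fun q => d + q) (add_right_injective d)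
    fun q hq => absurd ⟨q - d, add_sub_cancel d q⟩ hq

theorem locFin_shift {V : Type*} [AddCommGroup V] [Module ℂ V] {T : ℤ → Module.End ℂ V}
    (hT : LocFin T) (d : ℤ) : LocFin fun q => T (d + q) :=
  (locFin_comp_iff (f := fun q => d + q) (add_right_injective d)
    fun q hq => absurd ⟨q - d, add_sub_cancel d q⟩ hq).2 hT

theorem locFin_of_eq_zero {V ι : Type*} [AddCommGroup V] [Module ℂ V] {T : ι → Module.End ℂ V}
    (s : ι) (h : ∀ q, q ≠ s → T q = 0) : LocFin T := fun P =>
  (Set.finite_singleton s).subset fun q hq => by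
    by_contra hne
    exact hq (by simp [h q hne])

theorem lie_PM {T : Module.End ℂ (Fock n)} {u v u' v' : ℕ × ℕ} (d t : ℤ) {α β β₀ : ℂ}
    (huv : u.2 ≤ v.2) (hu' : u'.2 ≤ v.2) (hv' : u.2 ≤ v'.2)
    (hA : ∀ q, ⁅T, aM n r u q⁆ = α • aM n r u' (d + q))
    (hS : ∀ q, ⁅T, sM n r v q⁆ =
      (if d + q = 0 then β₀ else 0) • 1 + β • sM n r v' (d + q))
    (h1 : α = 0 ∨ ∀ q, ⁅aM n r u' (d + q), sM n r v (t - q)⁆ = 0)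
    (h2 : β = 0 ∨ ∀ q, ⁅aM n r u q, sM n r v' (d + t - q)⁆ = 0) :
    ⁅T, PM n r u v t⁆ =
      α • PM n r u' v (d + t) + β • PM n r u v' (d + t) + β₀ • aM n r u (d + t) := by
  have key (q : ℤ) : ⁅T, nord [aF n r u q, sF n r v (t - q)]⁆ =
      α • nord [aF n r u' (d + q), sF n r v (d + t - (d + q))] +
      β • nord [aF n r u q, sF n r v' (d + t - q)] +
      (if True ∧ d + t - q + 0 = 0 then β₀ else 0) • aM n r u q := by
    have e1 : d + t - (d + q) = t - q := by ring
    have e2 : d + (t - q) = d + t - q := by ring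
    have c1 : ⁅α • aM n r u' (d + q), sM n r v (t - q)⁆ = 0 := by
      rcases h1 with h | h
      · rw [h, zero_smul, zero_lie]
      · rw [smul_lie, h q, smul_zero]
    have c2 : ⁅aM n r u q, β • sM n r v' (d + t - q)⁆ = 0 := by
      rcases h2 with h | h
      · rw [h, zero_smul, lie_zero]
      · rw [lie_smul, h q, smul_zero]
    have h3 : ⁅T, sM n r v (t - q)⁆ =
        (if True ∧ d + t - q + 0 = 0 then β₀ else 0) • 1 + β • sM n r v' (d + t - q) := by
      simp only [hS, e2, true_and, add_zero]
    have p1 : α • nord [aF n r u' (d + q), sF n r v (t - q)] =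
        α • (aM n r u' (d + q) * sM n r v (t - q)) := by
      rcases h1 with h | h
      · rw [h, zero_smul, zero_smul]
      · rw [aF, sF, nord_pair_of_lie_eq_zero (h q)]
    have p2 : β • nord [aF n r u q, sF n r v' (d + t - q)] =
        β • (aM n r u q * sM n r v' (d + t - q)) := by
      rcases h2 with h | h
      · rw [h, zero_smul, zero_smul]
      · rw [aF, sF, nord_pair_of_lie_eq_zero (h q)]
    have h4 : ⁅aM n r u q, (if True ∧ d + t - q + 0 = 0 then β₀ else 0) •
        (1 : Module.End ℂ (Fock n)) + β • sM n r v' (d + t - q)⁆ = 0 := by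
      rw [lie_add, c2, lie_smul]
      simp [Ring.lie_def]
    rw [e1, p1, p2, aF, sF, lie_nord_pair (hA q) h3 c1 h4]
    rw [mul_add, smul_mul_assoc, mul_smul_comm, mul_smul_comm, mul_one]
    abel
  have l1 := locFin_shift (locFin_P (n := n) (r := r) hu' (d + t)) d
  have l2 := locFin_P (n := n) (r := r) hv' (d + t)
  rw [PM, lie_LSum (locFin_P huv t)]
  simp only [key]
  have l3 : LocFin fun q => (if True ∧ d + t - q + 0 = 0 then β₀ else 0) • aM n r u q :=
    locFin_of_eq_zero (d + t) fun q hq => by rw [if_neg (by omega), zero_smul]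
  rw [LSum_add ((l1.smul α).add (l2.smul β)) l3, LSum_add (l1.smul α) (l2.smul β), LSum_smul l1,
    LSum_smul l2, LSum_smul_single _ _ _ _ (d + t) (by ring),
    LSum_shift (fun q => nord [aF n r u' q, sF n r v (d + t - q)]), if_pos trivial]
  rfl

theorem lie_SSM {T : Module.End ℂ (Fock n)} {u v u' v' : ℕ × ℕ} (d t : ℤ) {α α₀ β β₀ : ℂ}
    (hu : ∀ q, ⁅T, sM n r u q⁆ =
      (if d + q = 0 then α₀ else 0) • 1 + α • sM n r u' (d + q))
    (hv : ∀ q, ⁅T, sM n r v q⁆ =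
      (if d + q = 0 then β₀ else 0) • 1 + β • sM n r v' (d + q)) :
    ⁅T, SSM n r u v t⁆ = α • SSM n r u' v (d + t) + α₀ • sM n r v (d + t) +
      (β • SSM n r u v' (d + t) + β₀ • sM n r u (d + t)) := by
  have key (q : ℤ) : ⁅T, sM n r u q * sM n r v (t - q)⁆ =
      α • (sM n r u' (d + q) * sM n r v (d + t - (d + q))) +
      (if True ∧ q + d = 0 then α₀ else 0) • sM n r v (t - q) +
      (β • (sM n r u q * sM n r v' (d + t - q)) +
      (if True ∧ d + t - q + 0 = 0 then β₀ else 0) • sM n r u q) := by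
    have e1 : d + t - (d + q) = t - q := by ring
    have e2 : d + (t - q) = d + t - q := by ring
    rw [lie_mul_eq, hu, hv, e1, e2]
    simp only [mul_add, add_mul, smul_mul_assoc, mul_smul_comm, mul_one, one_mul, true_and,
      add_zero, add_comm q d]
    abel
  have l1 := (locFin_shift (locFin_SS (n := n) (r := r) u' v (d + t)) d).smul α
  have l2 := (locFin_SS (n := n) (r := r) u v' (d + t)).smul β
  have l3 : LocFin fun q => (if True ∧ d + t - q + 0 = 0 then β₀ else 0) • sM n r u q :=
    locFin_of_eq_zero (d + t) fun q hq => by rw [if_neg (by omega), zero_smul]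
  have l4 : LocFin fun q => (if True ∧ q + d = 0 then α₀ else 0) • sM n r v (t - q) :=
    locFin_of_eq_zero (-d) fun q hq => by rw [if_neg (by omega), zero_smul]
  rw [SSM, lie_LSum (locFin_SS u v t)]
  simp only [key]
  rw [LSum_add (l1.add l4) (l2.add l3), LSum_add l1 l4, LSum_add l2 l3,
    LSum_smul (locFin_shift (locFin_SS (n := n) (r := r) u' v (d + t)) d),
    LSum_smul (locFin_SS (n := n) (r := r) u v' (d + t)),
    LSum_smul_single _ _ _ _ (d + t) (by ring),
    LSum_smul_single' _ _ _ (-d) rfl fun q => sM n r v (t - q),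
    LSum_shift (fun q => sM n r u' q * sM n r v (d + t - q)), if_pos trivial, if_pos trivial,
    sub_neg_eq_add, add_comm t d]
  rfl

theorem exists_eq_smul_one {T : Module.End ℂ (Fock n)}
    (ha : ∀ w : ℕ × ℕ, w.1 < n → w.2 < n → ∀ q, ⁅T, aM n r w q⁆ = 0)
    (hs : ∀ w : ℕ × ℕ, w.1 < n → w.2 < n → ∀ q, ⁅T, sM n r w q⁆ = 0)
    (hy : ∀ k q, ⁅T, yM n k q⁆ = 0) : ∃ c : ℂ, T = c • 1 := by
  refine eq_smul_one_of_lie_eq_zero (fun v => ?_) fun v => ?_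
  · rcases v with ⟨i, j, m⟩ | ⟨k, d⟩
    · by_cases h : 0 ≤ m ∧ (j : ℕ) + 1 ≤ r
      · have := hs (i, j) i.2 j.2 (-m)
        rwa [sM, dif_pos ⟨i.2, j.2⟩, if_pos (by simpa using h), neg_neg] at this
      · have := ha (i, j) i.2 j.2 m
        rwa [aM, dif_pos ⟨i.2, j.2⟩, if_neg h] at this
    · have := hy k (-d)
      have hd : (0 : ℤ) < d := by exact_mod_cast d.2
      have e : toPos (- -(d : ℤ)) (by omega) = d := by
        refine Subtype.ext ?_
        simp only [toPos, neg_neg, Int.toNat_natCast]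
        rfl
      rwa [yM, dif_neg (by omega), dif_pos (by omega), e] at this
  · rcases v with ⟨i, j, m⟩ | ⟨k, d⟩
    · by_cases h : 0 ≤ m ∧ (j : ℕ) + 1 ≤ r
      · have := ha (i, j) i.2 j.2 m
        rwa [aM, dif_pos ⟨i.2, j.2⟩, if_pos h] at this
      · have := hs (i, j) i.2 j.2 (-m)
        rwa [sM, dif_pos ⟨i.2, j.2⟩, if_neg (by simpa using h), neg_neg, lie_neg, neg_eq_zero]
          at this
    · have := hy k d
      have hd : (0 : ℤ) < d := by exact_mod_cast d.2
      have e : toPos (d : ℤ) hd = d := by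
        refine Subtype.ext ?_
        simp only [toPos, Int.toNat_natCast]
        rfl
      rw [yM, dif_pos hd, e, lie_smul] at this
      exact (smul_eq_zero.1 this).resolve_left (by exact_mod_cast hd.ne')

variable (n) in
/-- The vacuum vector. -/
noncomputable def vac : Fock n := (1 : PXY n)

theorem vac_ne_zero : vac n ≠ 0 := (one_ne_zero : (1 : PXY n) ≠ 0)

theorem der_vac (v : Idx n) : der v (vac n) = 0 := (pderiv v).map_one_eq_zero

theorem aM_vac {u : ℕ × ℕ} {q : ℤ} (h : 0 ≤ q ∧ u.2 + 1 ≤ r) : aM n r u q (vac n) = 0 := by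
  unfold aM
  split_ifs
  · exact der_vac _
  · rfl

theorem sM_vac {u : ℕ × ℕ} {q : ℤ} (h : ¬(q ≤ 0 ∧ u.2 + 1 ≤ r)) : sM n r u q (vac n) = 0 := by
  unfold sM
  split_ifs
  · rw [LinearMap.neg_apply, der_vac, neg_zero]
  · rfl

theorem nord_a_s_vac {u v : ℕ × ℕ} {p q : ℤ}
    (h : (0 ≤ p ∧ u.2 + 1 ≤ r) ∨ ¬(q ≤ 0 ∧ v.2 + 1 ≤ r)) :
    nord [aF n r u p, sF n r v q] (vac n) = 0 := by
  by_cases h1 : 0 ≤ p ∧ u.2 + 1 ≤ r <;> by_cases h2 : q ≤ 0 ∧ v.2 + 1 ≤ r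
  · simp [nord, aF, sF, h1, h2, aM_vac]
  · rw [aF, sF, decide_eq_true h1, decide_eq_false h2]
    simp [nord, sM_vac h2]
  · tauto
  · rw [aF, sF, decide_eq_false h1, decide_eq_false h2]
    simp [nord, sM_vac h2]

theorem P_vac {u : ℕ × ℕ} {m : ℤ} (h : 0 ≤ m ∨ r < u.2 + 1) : PM n r u u m (vac n) = 0 := by
  rw [PM, LSum_apply (locFin_P le_rfl m)]
  have key (q : ℤ) : nord [aF n r u q, sF n r u (m - q)] (vac n) = 0 := nord_a_s_vac (by omega)
  simp only [key, finsum_zero]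

theorem lie_lie_eq {V : Type*} [AddCommGroup V] [Module ℂ V] (x y z : Module.End ℂ V) :
    ⁅⁅x, y⁆, z⁆ = ⁅x, ⁅y, z⁆⁆ - ⁅y, ⁅x, z⁆⁆ := lie_lie x y z

theorem P_P_vac {u : ℕ × ℕ} (hu : u.1 < n ∧ u.2 < n) {m : ℤ} (hm : 0 < m) (hr : u.2 + 1 ≤ r) :
    PM n r u u m (PM n r u u (-m) (vac n)) = (-m : ℂ) • vac n := by
  rw [← Module.End.mul_apply, PM, PM, ← LSum_mul_left (locFin_P le_rfl (-m)),
    LSum_apply ((locFin_P le_rfl (-m)).mul_left _), ← PM]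
  have key (q : ℤ) : (PM n r u u m * nord [aF n r u q, sF n r u (-m - q)]) (vac n) =
      if -m ≤ q ∧ q < 0 then -vac n else 0 := by
    rw [Module.End.mul_apply]
    by_cases h : -m ≤ q ∧ q < 0
    · rw [if_pos h, aF, sF, decide_eq_false (by omega), decide_eq_true (by omega)]
      have e : nord [(aM n r u q, false), (sM n r u (-m - q), !true)] =
          aM n r u q * sM n r u (-m - q) := by
        simp [nord]
      have c1 := lie_mul_eq (PM n r u u m) (aM n r u q) (sM n r u (-m - q))
      rw [lie_P_a le_rfl hu, lie_P_s le_rfl hu, if_pos rfl, if_pos rfl] at c1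
      have c2 := LinearMap.congr_fun c1 (vac n)
      have c3 := LinearMap.congr_fun (lie_a_s (r := r) u u hu (m + q) (-m - q)) (vac n)
      rw [if_pos ⟨rfl, by ring⟩, one_smul, Ring.lie_def, LinearMap.sub_apply,
        Module.End.mul_apply, Module.End.mul_apply, aM_vac (by omega), map_zero, sub_zero] at c3
      simp only [Ring.lie_def, LinearMap.sub_apply, LinearMap.add_apply, LinearMap.neg_apply,
        Module.End.mul_apply, P_vac (Or.inl hm.le), map_zero, sub_zero, c3, neg_mul] at c2
      rw [sM_vac (q := m + (-m - q)) (by omega), map_zero, add_zero] at c2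
      rw [e]
      exact c2
    · rw [if_neg h, nord_a_s_vac (by omega), map_zero]
  simp only [key]
  rw [finsum_eq_sum_of_support_subset (s := Finset.Ico (-m) 0)]
  · rw [Finset.sum_congr rfl fun q hq => if_pos (Finset.mem_Ico.1 hq), Finset.sum_const,
      Int.card_Ico, sub_neg_eq_add, zero_add, smul_neg, neg_smul, ← Nat.cast_smul_eq_nsmul ℂ]
    congr 2
    exact_mod_cast Int.toNat_of_nonneg hm.le
  · intro q hq
    by_contra h
    exact hq (if_neg fun h' => h (by simpa using h'))

theorem lie_P_P_self {u : ℕ × ℕ} (hu : u.1 < n ∧ u.2 < n) (m t : ℤ) :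
    ⁅PM n r u u m, PM n r u u t⁆ =
      (if m + t = 0 ∧ u.2 + 1 ≤ r then -(m : ℂ) else 0) • 1 := by
  by_cases h : m + t = 0
  swap
  · rw [lie_PM (β₀ := 0) (α := -1) (β := 1) (u' := u) (v' := u) m t le_rfl le_rfl le_rfl
      (fun q => by rw [lie_P_a le_rfl hu, if_pos rfl, neg_one_smul])
      (fun q => by rw [lie_P_s le_rfl hu, if_pos rfl, one_smul, ite_self, zero_smul, zero_add])
      (Or.inr fun q => by rw [lie_a_s _ _ hu, if_neg (by omega), zero_smul])
      (Or.inr fun q => by rw [lie_a_s _ _ hu, if_neg (by omega), zero_smul])]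
    simp [h]
  have pos (m : ℤ) (hm : 0 < m) : ⁅PM n r u u m, PM n r u u (-m)⁆ =
      (if u.2 + 1 ≤ r then -(m : ℂ) else 0) • 1 := by
    obtain ⟨c, hc⟩ : ∃ c : ℂ, ⁅PM n r u u m, PM n r u u (-m)⁆ = c • 1 := by
      refine exists_eq_smul_one (r := r) (fun w h1 h2 q => ?_) (fun w h1 h2 q => ?_) fun k q => ?_
      · simp only [lie_lie_eq, lie_P_a le_rfl ⟨h1, h2⟩]
        split_ifs with hw
        · subst hw
          simp only [lie_neg, lie_P_a le_rfl ⟨h1, h2⟩, if_true, neg_neg]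
          rw [show -m + (m + q) = m + (-m + q) by ring, sub_self]
        · simp
      · simp only [lie_lie_eq, lie_P_s le_rfl ⟨h1, h2⟩]
        split_ifs with hw
        · subst hw
          simp only [lie_P_s le_rfl ⟨h1, h2⟩, if_true]
          rw [show -m + (m + q) = m + (-m + q) by ring, sub_self]
        · simp
      · simp only [lie_lie_eq, lie_P_y le_rfl, lie_zero, sub_zero]
    have hv := LinearMap.congr_fun hc (vac n)
    rw [Ring.lie_def, LinearMap.sub_apply, Module.End.mul_apply, Module.End.mul_apply,
      P_vac (Or.inl hm.le), map_zero, sub_zero] at hv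
    rw [hc]
    congr 1
    change _ = c • vac n at hv
    split_ifs with hr
    · rw [P_P_vac hu hm hr] at hv
      exact (smul_left_injective ℂ vac_ne_zero hv).symm
    · rw [P_vac (m := -m) (Or.inr (by omega)), map_zero] at hv
      exact (smul_eq_zero.1 hv.symm).resolve_right vac_ne_zero
  obtain rfl : t = -m := by omega
  simp only [h, true_and]
  rcases lt_trichotomy m 0 with hm | rfl | hm
  · have := pos (-m) (by omega)
    rw [neg_neg] at this
    rw [← lie_skew, this, ← neg_smul]
    congr 1
    split_ifs <;> simp
  · simp
  · exact pos m hm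

theorem lie_D_P_self (wt : ℕ × ℕ → ℤ) {u : ℕ × ℕ} (hu : u.1 < n ∧ u.2 < n) (m t : ℤ) :
    ⁅DM n r wt m, PM n r u u t⁆ =
      (if m + t = 0 ∧ u.2 + 1 ≤ r then -(m : ℂ) * wt u else 0) • 1 := by
  have key (w : ℕ × ℕ) : ⁅PM n r w w m, PM n r u u t⁆ =
      if w = u then (if m + t = 0 ∧ u.2 + 1 ≤ r then -(m : ℂ) else 0) • 1 else 0 := by
    by_cases h : w = u
    · rw [if_pos h, h, lie_P_P_self hu]
    · rw [if_neg h, lie_PM (β₀ := 0) (α := 0) (β := 0) (u' := u) (v' := u) m t le_rfl le_rfl le_rfl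
        (fun q => by rw [lie_P_a le_rfl hu, if_neg (Ne.symm h), zero_smul])
        (fun q => by rw [lie_P_s le_rfl hu, if_neg h, ite_self, zero_smul, zero_smul, zero_add])
        (Or.inl rfl) (Or.inl rfl)]
      simp
  simp only [DM, sum_lie, smul_lie, key, smul_ite, smul_zero, Finset.sum_ite_eq']
  rw [if_pos (by simpa using hu), smul_smul]
  congr 1
  split_ifs <;> ring

theorem lie_D_P (wt : ℕ × ℕ → ℤ) {u v : ℕ × ℕ} (hu : u.1 < n ∧ u.2 < n) (hv : v.1 < n ∧ v.2 < n)
    (huv : u.2 ≤ v.2) (hne : u ≠ v) (m t : ℤ) :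
    ⁅DM n r wt m, PM n r u v t⁆ = ((wt v - wt u : ℤ) : ℂ) • PM n r u v (m + t) := by
  rw [lie_PM (β₀ := 0) (α := -wt u) (β := wt v) (u' := u) (v' := v) m t huv huv huv
      (fun q => by rw [lie_D_a _ hu])
      (fun q => by rw [lie_D_s _ hv, ite_self, zero_smul, zero_add])
      (Or.inr fun q => lie_a_s_of_ne hne _ _) (Or.inr fun q => lie_a_s_of_ne hne _ _)]
  push_cast
  module

end QuadraticBrackets

section HeightGrading

variable {n r : ℕ}

/-- The height of the root `α_k + ⋯ + α_l`. -/
def ht (u : ℕ × ℕ) : ℤ := u.2 + 1 - u.1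

variable (n r) in
/-- The operator grading the Fock space by height. -/
noncomputable def KM : Module.End ℂ (Fock n) := DM n r ht 0

theorem lie_K_s {w : ℕ × ℕ} (hw : w.1 < n ∧ w.2 < n) (t : ℤ) :
    ⁅KM n r, sM n r w t⁆ = (ht w : ℂ) • sM n r w t := by
  rw [KM, lie_D_s _ hw, zero_add]

theorem lie_K_a {w : ℕ × ℕ} (hw : w.1 < n ∧ w.2 < n) (t : ℤ) :
    ⁅KM n r, aM n r w t⁆ = (-ht w : ℂ) • aM n r w t := by
  rw [KM, lie_D_a _ hw, zero_add]

theorem lie_K_y (k : Fin n) (t : ℤ) : ⁅KM n r, yM n k t⁆ = 0 := lie_D_y _ _ _ _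

theorem lie_K_P {u v : ℕ × ℕ} (hu : u.1 < n ∧ u.2 < n) (hv : v.1 < n ∧ v.2 < n)
    (huv : u.2 ≤ v.2) (hne : u ≠ v) (t : ℤ) :
    ⁅KM n r, PM n r u v t⁆ = ((ht v - ht u : ℤ) : ℂ) • PM n r u v t := by
  rw [KM, lie_D_P _ hu hv huv hne, zero_add]

theorem lie_K_C {u v : ℕ × ℕ} (hu : u.1 < n ∧ u.2 < n) (hv : v.1 < n ∧ v.2 < n)
    (huv : u.2 ≤ v.2) (t : ℤ) :
    ⁅KM n r, CM n r v u t⁆ = (ht v : ℂ) • CM n r v u t := by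
  rw [CM, lie_LSum (locFin_C huv t), ← LSum_smul (locFin_C huv t)]
  congr 1
  funext q
  rw [sF, aF, sF, lie_nord_triple_of_eigen (lie_K_s hv _) (lie_K_a hu _) (lie_K_s hu _)]
  congr 1
  ring

theorem lie_K_B (e : ℕ → Fin n → ℂ) (lam : ℕ → ℂ) {u : ℕ × ℕ} (hu : u.1 < n ∧ u.2 < n) (i : ℕ)
    (t : ℤ) : ⁅KM n r, BM n r e lam u i t⁆ = (ht u : ℂ) • BM n r e lam u i t := by
  rw [BM, lie_LSum (locFin_B e lam u i t), ← LSum_smul (locFin_B e lam u i t)]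
  congr 1
  funext q
  rw [lie_mul_eq, lie_K_s hu, KM, lie_D_b, mul_zero, add_zero, smul_mul_assoc]

theorem lie_K_E (γ : ℂ) (e : ℕ → Fin n → ℂ) (lam : ℕ → ℂ) {i : ℕ} (hi : i < n) (m : ℤ) :
    ⁅KM n r, EM n r γ e lam i m⁆ = (1 : ℂ) • EM n r γ e lam i m := by
  have hv : ((i, i) : ℕ × ℕ).1 < n ∧ ((i, i) : ℕ × ℕ).2 < n := ⟨hi, hi⟩
  have h0 : (ht (i, i) : ℂ) = 1 := by simp [ht]
  have h1 : ∀ k ∈ Finset.range i, ⁅KM n r, CM n r (i, i) (k, i - 1) m⁆ =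
      CM n r (i, i) (k, i - 1) m := fun k hk => by
    rw [Finset.mem_range] at hk
    rw [lie_K_C ⟨by omega, by simp only; omega⟩ hv (by simp), h0, one_smul]
  have h2 : ∀ k ∈ Finset.range (i + 1), ⁅KM n r, CM n r (i, i) (k, i) m⁆ =
      CM n r (i, i) (k, i) m := fun k hk => by
    rw [Finset.mem_range] at hk
    rw [lie_K_C ⟨by omega, by simp only; omega⟩ hv (by simp), h0, one_smul]
  have h3 : ∀ l ∈ Finset.Ico (i + 1) n, ⁅KM n r, PM n r (i + 1, l) (i, l) m⁆ =
      PM n r (i + 1, l) (i, l) m := fun l hl => by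
    rw [Finset.mem_Ico] at hl
    rw [lie_K_P ⟨by simp only; omega, hl.2⟩ ⟨hi, hl.2⟩ (by simp) (by simp)]
    simp [ht]
  have h4 : ∀ k ∈ Finset.range i, ⁅KM n r, PM n r (k, i - 1) (k, i) m⁆ =
      PM n r (k, i - 1) (k, i) m := fun k hk => by
    rw [Finset.mem_range] at hk
    rw [lie_K_P ⟨by simp only; omega, by simp only; omega⟩ ⟨by simp only; omega, hi⟩ (by simp)
      (by simp; omega)]
    have : ht (k, i) - ht (k, i - 1) = 1 := by simp only [ht]; omega
    rw [this, Int.cast_one, one_smul]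
  simp only [EM, lie_add, lie_sub, lie_sum, lie_smul, one_smul]
  rw [Finset.sum_congr rfl h1, Finset.sum_congr rfl h2, Finset.sum_congr rfl h3,
    Finset.sum_congr rfl h4, lie_K_B e lam hv, lie_K_s hv, h0, one_smul, one_smul]

theorem lie_K_F {i : ℕ} (hi : i < n) (m : ℤ) :
    ⁅KM n r, FM n r i m⁆ = (-1 : ℂ) • FM n r i m := by
  have h0 : (ht (i, i) : ℂ) = 1 := by simp [ht]
  have h3 : ∀ l ∈ Finset.Ico (i + 1) n, ⁅KM n r, PM n r (i, l) (i + 1, l) m⁆ =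
      (-1 : ℂ) • PM n r (i, l) (i + 1, l) m := fun l hl => by
    rw [Finset.mem_Ico] at hl
    rw [lie_K_P ⟨hi, hl.2⟩ ⟨by simp only; omega, hl.2⟩ (by simp) (by simp)]
    simp [ht]
  rw [FM, lie_add, lie_sum, Finset.sum_congr rfl h3, lie_K_a ⟨hi, hi⟩, h0, ← Finset.smul_sum,
    smul_add]

theorem lie_K_H (e : ℕ → Fin n → ℂ) (lam : ℕ → ℂ) (i : ℕ) (m : ℤ) :
    ⁅KM n r, HM n r e lam i m⁆ = (0 : ℂ) • HM n r e lam i m := by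
  have h : ∀ u ∈ Finset.range n ×ˢ Finset.range n,
      ⁅KM n r, (pr i u : ℂ) • PM n r u u m⁆ = 0 := fun u hu => by
    rw [lie_smul, KM, lie_D_P_self _ (by simpa using hu)]
    simp
  rw [HM, DM, lie_add, lie_sum, Finset.sum_eq_zero h, KM, lie_D_b, add_zero, zero_smul]

theorem lie_K_lie {S T : Module.End ℂ (Fock n)} {c d : ℂ} (hS : ⁅KM n r, S⁆ = c • S)
    (hT : ⁅KM n r, T⁆ = d • T) : ⁅KM n r, ⁅S, T⁆⁆ = (c + d) • ⁅S, T⁆ := by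
  rw [leibniz_lie, hS, hT, smul_lie, lie_smul, add_smul]

theorem lie_K_sub {S T : Module.End ℂ (Fock n)} {c : ℂ} (hS : ⁅KM n r, S⁆ = c • S)
    (hT : ⁅KM n r, T⁆ = c • T) : ⁅KM n r, S - T⁆ = c • (S - T) := by
  rw [lie_sub, hS, hT, smul_sub]

theorem lie_K_smul {S : Module.End ℂ (Fock n)} {c d : ℂ} (hS : ⁅KM n r, S⁆ = c • S) :
    ⁅KM n r, d • S⁆ = c • (d • S) := by
  rw [lie_smul, hS, smul_comm]

/-- An operator of nonzero height that commutes with all oscillators vanishes. -/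
theorem eq_zero_of_lie_eq_zero {T : Module.End ℂ (Fock n)} {c : ℂ} (hc : c ≠ 0)
    (hT : ⁅KM n r, T⁆ = c • T)
    (ha : ∀ w : ℕ × ℕ, w.1 < n → w.2 < n → ∀ q, ⁅T, aM n r w q⁆ = 0)
    (hs : ∀ w : ℕ × ℕ, w.1 < n → w.2 < n → ∀ q, ⁅T, sM n r w q⁆ = 0)
    (hy : ∀ k q, ⁅T, yM n k q⁆ = 0) : T = 0 := by
  obtain ⟨d, rfl⟩ := exists_eq_smul_one ha hs hy
  have h0 : ⁅KM n r, d • (1 : Module.End ℂ (Fock n))⁆ = 0 := by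
    rw [lie_smul, Ring.lie_def, mul_one, one_mul, sub_self, smul_zero]
  rw [h0] at hT
  exact (smul_eq_zero.1 hT.symm).resolve_left hc

theorem lie_one_eq (T : Module.End ℂ (Fock n)) : ⁅T, (1 : Module.End ℂ (Fock n))⁆ = 0 := by
  rw [Ring.lie_def, mul_one, one_mul, sub_self]

theorem one_lie_eq (T : Module.End ℂ (Fock n)) : ⁅(1 : Module.End ℂ (Fock n)), T⁆ = 0 := by
  rw [Ring.lie_def, mul_one, one_mul, sub_self]

/-- An operator commuting with all oscillators commutes with everything. -/
theorem lie_eq_zero_of_generators {T : Module.End ℂ (Fock n)}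
    (ha : ∀ w : ℕ × ℕ, w.1 < n → w.2 < n → ∀ q, ⁅T, aM n r w q⁆ = 0)
    (hs : ∀ w : ℕ × ℕ, w.1 < n → w.2 < n → ∀ q, ⁅T, sM n r w q⁆ = 0)
    (hy : ∀ k q, ⁅T, yM n k q⁆ = 0) (S : Module.End ℂ (Fock n)) : ⁅T, S⁆ = 0 := by
  obtain ⟨d, rfl⟩ := exists_eq_smul_one ha hs hy
  rw [smul_lie, one_lie_eq, smul_zero]

end HeightGrading

section ChevalleyRelations

variable {n r : ℕ}

theorem lie_F_SS {i a b : ℕ} (hi : i < n) (k : ℕ) (ha : a < n) (hb : b < n) (hai : b ≤ i)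
    (m t : ℤ) :
    ⁅FM n r k m, SSM n r (i, i) (a, b) t⁆ =
      (if k = i then sM n r (a, b) (m + t) else 0)
      + (if k = a ∧ k = b then sM n r (i, i) (m + t) else 0)
      + if k < b ∧ k = a then SSM n r (i, i) (k + 1, b) (m + t) else 0 := by
  rw [lie_SSM (α := 0) (α₀ := if k = i then 1 else 0) (u' := (0, 0))
    (β₀ := if k = a ∧ k = b then 1 else 0)
    (β := if k < b ∧ k = a then 1 else 0) (v' := (k + 1, b)) m t]
  · simp only [ite_smul, one_smul, zero_smul]
    abel
  · intro q
    rw [lie_F_s hi hi]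
    by_cases h : k = i
    · subst h
      simp
    · simp [h]
  · intro q
    rw [lie_F_s ha hb]
    by_cases h : k = a
    · subst h
      simp only [true_and, and_true, Nat.add_one_le_iff, hb, ite_smul, one_smul, zero_smul]
      congr 1
      split_ifs <;> simp_all
    · simp [h]

theorem lie_F_P_right {i a b : ℕ} (hi : i < n) (k : ℕ) (ha : a < n) (hb : b < n) (hbi : b ≤ i)
    (m t : ℤ) :
    ⁅FM n r k m, PM n r (a, b) (i, i) t⁆ =
      (if k < b ∧ k + 1 = a then -PM n r (k, b) (i, i) (m + t) else 0)
      + if k = i then aM n r (a, b) (m + t) else 0 := by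
  rw [lie_PM (α := if k < b ∧ k + 1 = a then -1 else 0) (u' := (k, b)) (β := 0)
    (β₀ := if k = i then 1 else 0) (v' := (i, i)) m t hbi hbi hbi]
  · simp only [ite_smul, one_smul, zero_smul, neg_smul, add_zero]
  · intro q
    rw [lie_F_a ha hb]
    simp only [Nat.add_one_le_iff, hb, and_true, ite_smul, neg_smul, one_smul, zero_smul]
  · intro q
    rw [lie_F_s hi hi]
    by_cases h : k = i
    · subst h
      simp
    · simp [h]
  · by_cases h : k < b ∧ k + 1 = a
    · exact Or.inr fun q => lie_a_s_of_ne (by simp; omega) _ _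
    · exact Or.inl (if_neg h)
  · exact Or.inl rfl

theorem lie_F_P_self {a b : ℕ} (k : ℕ) (ha : a < n) (hb : b < n) (m t : ℤ) :
    ⁅FM n r k m, PM n r (a, b) (a, b) t⁆ =
      (if k < b ∧ k + 1 = a then -PM n r (k, b) (k + 1, b) (m + t) else 0)
      + (if k < b ∧ k = a then PM n r (k, b) (k + 1, b) (m + t) else 0)
      + if k = a ∧ k = b then aM n r (k, k) (m + t) else 0 := by
  rw [lie_PM (u := (a, b)) (v := (a, b)) (α := if k < b ∧ k + 1 = a then -1 else 0) (u' := (k, b))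
    (β := if k < b ∧ k = a then 1 else 0) (v' := (k + 1, b))
    (β₀ := if k = a ∧ k = b then 1 else 0) m t le_rfl le_rfl le_rfl]
  · simp only [ite_smul, one_smul, zero_smul, neg_smul]
    congr 1
    · congr 1 <;> split_ifs with h
      · rw [h.2]
      · rfl
      · rw [h.2]
      · rfl
    · split_ifs with h
      · rw [← h.1, ← h.2]
      · rfl
  · intro q
    rw [lie_F_a ha hb]
    simp only [Nat.add_one_le_iff, hb, and_true, ite_smul, neg_smul, one_smul, zero_smul]
  · intro q
    rw [lie_F_s ha hb]
    simp only [Nat.add_one_le_iff, hb, and_true, ite_smul, one_smul, zero_smul]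
    congr 1
    split_ifs <;> first | rfl | simp only [zero_smul] | omega
  · by_cases h : k < b ∧ k + 1 = a
    · exact Or.inr fun q => lie_a_s_of_ne (by simp; omega) _ _
    · exact Or.inl (if_neg h)
  · by_cases h : k < b ∧ k = a
    · exact Or.inr fun q => lie_a_s_of_ne (by simp; omega) _ _
    · exact Or.inl (if_neg h)

theorem sum_lie_F_P_self {b : ℕ} (k : ℕ) (hb : b < n) (m t : ℤ) :
    ∑ a ∈ Finset.range (b + 1), ⁅FM n r k m, PM n r (a, b) (a, b) t⁆ =
      if k = b then aM n r (k, k) (m + t) else 0 := by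
  rw [Finset.sum_congr rfl fun a ha => lie_F_P_self k
    (lt_of_lt_of_le (Finset.mem_range.1 ha) hb) hb m t]
  simp only [ite_and, Finset.sum_add_distrib]
  by_cases h : k < b
  · simp only [h, if_true, h.ne, if_false, Finset.sum_ite_eq, Finset.mem_range, ite_self,
      Finset.sum_const_zero, add_zero, Nat.lt_succ_of_lt h]
    simp [h]
  · by_cases h' : k = b <;> simp [h, h']

variable (e : ℕ → Fin n → ℂ) (lam : ℕ → ℂ)

theorem lie_F_Ht {i : ℕ} (hi : i < n) (k : ℕ) (m t : ℤ) :
    ⁅FM n r k m, HtM n r e lam i t⁆ =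
      (if k = i then (2 : ℂ) • aM n r (i, i) (m + t) else 0)
      + if k + 1 = i then -aM n r (k, k) (m + t) - PM n r (k, i) (i, i) (m + t) else 0 := by
  have h1 : ∑ a ∈ Finset.range i, ⁅FM n r k m, PM n r (a, i - 1) (a, i - 1) t⁆ =
      if k + 1 = i then aM n r (k, k) (m + t) else 0 := by
    rcases i with _ | i
    · simp
    · simp only [add_tsub_cancel_right, Nat.add_right_cancel_iff]
      exact sum_lie_F_P_self k (by omega) m t
  simp only [HtM, lie_add, lie_neg, lie_sum, h1, sum_lie_F_P_self k hi, lie_F_b, add_zero,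
    lie_F_P_self k hi hi, and_self]
  by_cases h : k = i
  · subst h
    simp [two_smul]
  · by_cases h' : k + 1 = i
    · subst h'
      simp
      abel
    · simp [h, h']

theorem pr_add_left {j l : ℕ} (i : ℕ) (h : j < l) :
    pr i (j, l) = pr i (j, j) + pr i (j + 1, l) := by
  simp only [pr]
  split_ifs <;> omega

theorem pr_add_right {k j : ℕ} (i : ℕ) (h : k < j) :
    pr i (k, j) = pr i (k, j - 1) + pr i (j, j) := by
  simp only [pr]
  split_ifs <;> omega

end ChevalleyRelations

section EFRelations

variable {n r : ℕ} (γ : ℂ) (e : ℕ → Fin n → ℂ) (lam : ℕ → ℂ)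

theorem lie_EF_self_s {i k l : ℕ} (hi : i < n) (hk : k < n) (hl : l < n) (m t q : ℤ) :
    ⁅⁅EM n r γ e lam i m, FM n r i t⁆ - HM n r e lam i (m + t), sM n r (k, l) q⁆ = 0 := by
  have hw : ((k, l) : ℕ × ℕ).1 < n ∧ ((k, l) : ℕ × ℕ).2 < n := ⟨hk, hl⟩
  have e1 : t + (m + q) = m + t + q := by ring
  have e2 : m + (t + q) = m + t + q := by ring
  rw [sub_lie, lie_lie_eq, lie_F_s hk hl, lie_E_s γ e lam hk hl, lie_H_s e lam _ hw, lie_add,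
    lie_smul, lie_one_eq, smul_zero, zero_add]
  by_cases c1 : k < i ∧ i - 1 = l
  · obtain ⟨i, rfl⟩ : ∃ j, i = j + 1 := ⟨i - 1, by omega⟩
    obtain rfl : i = l := by omega
    have hp : pr (i + 1) (k, i) = -1 := by simp only [pr]; split_ifs <;> omega
    have c2 : ¬ (i + 1 = k) := by omega
    have c3 : ¬ (i + 1 = i) := by omega
    have c4 : ¬ (i + 1 + 1 ≤ i) := by omega
    simp [c1.1, c2, c4, hp, lie_F_SS hi _ hk hl, lie_F_s hk hi, e1]
  by_cases c2 : k < i ∧ i = l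
  · obtain ⟨c2, rfl⟩ := c2
    have hp : pr i (k, i) = 1 := by simp only [pr]; split_ifs <;> omega
    have c3 : ¬ (i = k) := by omega
    simp [c1, c3, Nat.lt_succ_of_lt c2, hp, lie_F_SS hi _ hk hl, e1]
  by_cases c3 : k = i ∧ i = l
  · obtain ⟨rfl, rfl⟩ := c3
    have hp : pr k (k, k) = 2 := by simp only [pr]; split_ifs <;> omega
    simp [hp, lie_F_SS hi _ hk hl, e1, ← two_smul ℂ]
  by_cases c4 : k = i ∧ i < l
  · obtain ⟨rfl, c4⟩ := c4
    have hp : pr k (k, l) = 1 := by simp only [pr]; split_ifs <;> omega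
    have c5 : k + 1 ≤ l := c4
    have c6 : ¬ (k - 1 = l) := by omega
    simp [hp, c5, c4.ne, c6, hl, lie_E_s γ e lam (show k + 1 < n by omega) hl, e2]
  by_cases c5 : k = i + 1 ∧ k ≤ l
  · obtain ⟨rfl, c5⟩ := c5
    have hp : pr i (i + 1, l) = -1 := by simp only [pr]; split_ifs <;> omega
    have c6 : ¬ (i = l) := by omega
    have c7 : ¬ (i - 1 = l) := by omega
    simp [hp, c5, c6, c7, hl, lie_F_s hi hl, e1]
  · have hp : pr i (k, l) = 0 := by simp only [pr]; split_ifs <;> omega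
    rw [if_neg (by omega), if_neg (by omega), if_neg (by omega), if_neg (by omega), hp]
    simp

theorem lie_EF_self_a {i k l : ℕ} (hi : i < n) (hk : k < n) (hl : l < n) (m t q : ℤ) :
    ⁅⁅EM n r γ e lam i m, FM n r i t⁆ - HM n r e lam i (m + t), aM n r (k, l) q⁆ = 0 := by
  have hw : ((k, l) : ℕ × ℕ).1 < n ∧ ((k, l) : ℕ × ℕ).2 < n := ⟨hk, hl⟩
  have e1 : t + (m + q) = m + t + q := by ring
  have e2 : m + (t + q) = m + t + q := by ring
  rw [sub_lie, lie_lie_eq, lie_F_a hk hl, lie_E_a γ e lam hk hl, lie_H_a e lam _ hw]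
  by_cases c1 : k < i ∧ i - 1 = l
  · obtain ⟨i, rfl⟩ : ∃ j, i = j + 1 := ⟨i - 1, by omega⟩
    obtain rfl : i = l := by omega
    have hp : pr (i + 1) (k, i) = -1 := by simp only [pr]; split_ifs <;> omega
    have c2 : ¬ (i + 1 = k) := by omega
    have c3 : ¬ (i + 1 + 1 = k) := by omega
    have c4 : ¬ (i + 1 + 1 ≤ i) := by omega
    simp [c1.1, c2, c3, c4, hp, lie_F_P_right hi _ hk hl, e1]
  by_cases c2 : k < i ∧ i = l
  · obtain ⟨c2, rfl⟩ := c2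
    have hp : pr i (k, i) = 1 := by simp only [pr]; split_ifs <;> omega
    have c3 : ¬ (i = k) := by omega
    have c4 : ¬ (i - 1 = i) := by omega
    simp [c2, c3, c4, hp, lie_F_P_right hi _ hk hl, lie_F_a hk (show i - 1 < n by omega),
      show ¬ (i + 1 = k) by omega, e1]
  by_cases c3 : k = i ∧ i = l
  · obtain ⟨rfl, rfl⟩ := c3
    have hp : pr k (k, k) = 2 := by simp only [pr]; split_ifs <;> omega
    simp [hp, lie_F_Ht e lam hi, e1]
    split_ifs <;> simp [lie_smul, lie_one_eq]
  by_cases c4 : k = i ∧ i < l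
  · obtain ⟨rfl, c4⟩ := c4
    have hp : pr k (k, l) = 1 := by simp only [pr]; split_ifs <;> omega
    have c5 : k + 1 ≤ l := c4
    simp [hp, c5, c4.ne, hl, lie_F_a (show k + 1 < n by omega) hl, e1]
  by_cases c5 : k = i + 1 ∧ k ≤ l
  · obtain ⟨rfl, c5⟩ := c5
    have hp : pr i (i + 1, l) = -1 := by simp only [pr]; split_ifs <;> omega
    have c6 : ¬ (i = l) := by omega
    simp [hp, c5, c6, hl, lie_E_a γ e lam hi hl, e2]
  · have hp : pr i (k, l) = 0 := by simp only [pr]; split_ifs <;> omega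
    rw [if_neg (by omega), if_neg (by omega), if_neg (by omega), if_neg (by omega),
      if_neg (by omega), hp]
    simp

theorem lie_EF_self_y {i : ℕ} (hi : i < n) (k : Fin n) (m t q : ℤ) :
    ⁅⁅EM n r γ e lam i m, FM n r i t⁆ - HM n r e lam i (m + t), yM n k q⁆ = 0 := by
  rw [sub_lie, lie_lie_eq, lie_F_y, lie_E_y, lie_H_y, lie_smul, lie_F_s hi hi, lie_zero,
    if_neg (show ¬((i + 1 ≤ i ∧ i < n) ∧ i = i) by omega), add_zero, zero_sub, smul_smul,
    ← neg_smul, ← sub_smul]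
  by_cases h : m + t + q = 0
  · rw [if_pos ⟨⟨rfl, rfl⟩, by omega⟩, if_pos h]
    obtain rfl : q = -(m + t) := by omega
    push_cast
    rw [show (-((-((m : ℂ) + t)) * e i k * 1) - (m + t) * e i k) = 0 by ring, zero_smul]
  · rw [if_neg (by omega), if_neg h]
    simp

/-- `[E_{i,m}, F_{i,t}] - H_{i,m+t}` is central. -/
theorem lie_lie_E_F_self {i : ℕ} (hi : i < n) (m t : ℤ) (S : Module.End ℂ (Fock n)) :
    ⁅⁅EM n r γ e lam i m, FM n r i t⁆, S⁆ = ⁅HM n r e lam i (m + t), S⁆ := by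
  rw [← sub_eq_zero, ← sub_lie]
  exact lie_eq_zero_of_generators (fun _ h1 h2 q => lie_EF_self_a γ e lam hi h1 h2 m t q)
    (fun _ h1 h2 q => lie_EF_self_s γ e lam hi h1 h2 m t q)
    (fun k q => lie_EF_self_y γ e lam hi k m t q) S

end EFRelations

section EFDistinct

variable {n r : ℕ} (γ : ℂ) (e : ℕ → Fin n → ℂ) (lam : ℕ → ℂ)

theorem lie_EF_ne_s {i j k l : ℕ} (hi : i < n) (hij : i ≠ j) (hk : k < n) (hl : l < n)
    (m t q : ℤ) : ⁅⁅EM n r γ e lam i m, FM n r j t⁆, sM n r (k, l) q⁆ = 0 := by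
  have e1 : t + (m + q) = m + t + q := by ring
  have e2 : m + (t + q) = m + t + q := by ring
  rw [lie_lie_eq, lie_F_s hk hl, lie_E_s γ e lam hk hl, lie_add, lie_smul, lie_one_eq, smul_zero,
    zero_add]
  have hk1 : k + 1 ≤ l → k + 1 < n := fun h => by omega
  by_cases c1 : k < i ∧ i - 1 = l
  · obtain ⟨i, rfl⟩ : ∃ j, i = j + 1 := ⟨i - 1, by omega⟩
    obtain rfl : i = l := by omega
    have c2 : ¬ (i + 1 = k) := by omega
    have c3 : ¬ (i + 1 = i) := by omega
    have c4 : ¬ (i + 1 + 1 ≤ i) := by omega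
    by_cases c5 : j = k
    · subst c5
      by_cases c6 : j = i
      · subst c6
        simp [hl, lie_F_SS hi _ hk hl, lie_F_s hk hi, hi, e1]
      · have c7 : j < i := by omega
        simp [c1.1, c2, c4, c6, c7, Ne.symm hij, hl, hi,
          lie_F_SS hi _ hk hl, lie_F_s hk hi, lie_E_s γ e lam (hk1 c7) hl,
          e1, e2]
        split_ifs <;> first | omega | simp
    · simp [c1.1, c4, c5, Ne.symm hij, hl, hi,
        lie_F_SS hi _ hk hl, lie_F_s hk hi, e1]
  by_cases c2 : k < i + 1 ∧ i = l
  · obtain ⟨c2, rfl⟩ := c2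
    have c3 : ¬ (i - 1 = i ∧ k < i) := by omega
    have c4 : ¬ (k < i ∧ i - 1 = i) := by omega
    by_cases c5 : j = k
    · subst c5
      have c6 : j < i := by omega
      simp [c2, c6, hij, Ne.symm hij, hi, lie_F_SS hi _ hk hl,
        lie_E_s γ e lam (hk1 c6) hl, e1, e2]
      split_ifs <;> first | omega | simp
    · simp [c2, c4, c5, Ne.symm hij, hi, lie_F_SS hi _ hk hl]
  by_cases c3 : i + 1 ≤ l ∧ i + 1 = k
  · obtain ⟨c3, rfl⟩ := c3
    simp [show ¬ (i + 1 < i) by omega, show ¬ (i = l) by omega, c3, hl, lie_F_s hi hl,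
      Ne.symm hij]
    split_ifs with h
    · obtain ⟨h, rfl⟩ := h
      rw [lie_E_s γ e lam (by omega) hl]
      rw [if_neg (by omega), if_neg (by omega), if_neg (by omega)]
      simp
    · simp
  · rw [if_neg c1, if_neg c2, if_neg (show ¬((i + 1 ≤ l ∧ l < n) ∧ i + 1 = k) by omega)]
    split_ifs with h
    · obtain ⟨h, rfl⟩ := h
      rw [lie_E_s γ e lam (by omega) hl]
      rw [if_neg (by omega), if_neg (by omega), if_neg (by omega)]
      simp
    · simp

theorem lie_EF_ne_a {i j k l : ℕ} (hi : i < n) (hij : i ≠ j) (hk : k < n) (hl : l < n)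
    (m t q : ℤ) : ⁅⁅EM n r γ e lam i m, FM n r j t⁆, aM n r (k, l) q⁆ = 0 := by
  have e1 : t + (m + q) = m + t + q := by ring
  have e2 : m + (t + q) = m + t + q := by ring
  rw [lie_lie_eq, lie_F_a hk hl, lie_E_a γ e lam hk hl]
  by_cases c1 : k < i ∧ i - 1 = l
  · obtain ⟨i, rfl⟩ : ∃ j, i = j + 1 := ⟨i - 1, by omega⟩
    obtain rfl : i = l := by omega
    simp [c1.1, show ¬ (i + 1 = k) by omega, show ¬ (i + 1 + 1 ≤ i) by omega,
      lie_F_P_right hi _ hk hl, Ne.symm hij, hl, e1]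
    split_ifs with h
    · rw [lie_neg, lie_E_a γ e lam (by omega) hl]
      simp [show j < i + 1 by omega, show ¬ (i + 1 = j) by omega, e2]
    · simp
  by_cases c2 : k < i ∧ i = l
  · obtain ⟨c2, rfl⟩ := c2
    simp [c2, show ¬ (i - 1 = i) by omega, show ¬ (i = k) by omega, lie_F_P_right hi _ hk hl,
      lie_F_a hk (show i - 1 < n by omega), Ne.symm hij, hl, e1]
    by_cases h : j + 1 = k
    · rw [if_pos (by omega), if_pos (by omega), if_pos (by omega),
        lie_neg, lie_E_a γ e lam (by omega) hl]
      simp [show j < i by omega, show ¬ (i - 1 = i) by omega, show ¬ (i = j) by omega, e2]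
      abel
    · simp [h]
  by_cases c3 : k = i ∧ i = l
  · obtain ⟨rfl, rfl⟩ := c3
    simp [lie_F_Ht e lam hi, Ne.symm hij, e1, hl]
    by_cases h : j + 1 = k
    · subst h
      simp [lie_E_a γ e lam (show j < n by omega) hl, e2]
      split_ifs <;> simp [lie_smul, lie_one_eq] <;> abel
    · simp [h]
      split_ifs <;> simp [lie_smul, lie_one_eq]
  by_cases c4 : k = i ∧ i < l
  · obtain ⟨rfl, c4⟩ := c4
    have c5 : k + 1 ≤ l := c4
    simp [c5, c4.ne, hl, lie_F_a (show k + 1 < n by omega) hl, Ne.symm hij]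
    split_ifs with h
    · rw [lie_neg, lie_E_a γ e lam (by omega) hl]
      rw [if_neg (by omega), if_neg (by omega), if_neg (by omega), if_neg (by omega)]
      simp
    · simp
  · rw [if_neg c1, if_neg c2, if_neg (show ¬((i + 1 ≤ l ∧ l < n) ∧ i = k) by omega),
      if_neg (show ¬(i = k ∧ i = l) by omega)]
    split_ifs with h
    · rw [lie_neg, lie_E_a γ e lam (by omega) hl]
      rw [if_neg (by omega), if_neg (by omega), if_neg (by omega), if_neg (by omega)]
      simp
    · simp

/-- `[E_{i,m}, F_{j,t}]` is central for `i ≠ j`. -/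
theorem lie_lie_E_F_ne {i j : ℕ} (hi : i < n) (hij : i ≠ j) (m t : ℤ)
    (S : Module.End ℂ (Fock n)) : ⁅⁅EM n r γ e lam i m, FM n r j t⁆, S⁆ = 0 := by
  refine lie_eq_zero_of_generators (fun _ h1 h2 q => lie_EF_ne_a γ e lam hi hij h1 h2 m t q)
    (fun _ h1 h2 q => lie_EF_ne_s γ e lam hi hij h1 h2 m t q) (fun k q => ?_) S
  rw [lie_lie_eq, lie_F_y, lie_E_y, lie_zero, lie_smul, lie_F_s hi hi,
    if_neg (show ¬((j = i ∧ j = i) ∧ t + (m + q) = 0) by omega),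
    if_neg (show ¬((j + 1 ≤ i ∧ i < n) ∧ j = i) by omega)]
  simp

end EFDistinct

section CartanRelations

variable {n r : ℕ} (γ : ℂ) (e : ℕ → Fin n → ℂ) (lam : ℕ → ℂ)

theorem lie_H_SS (i : ℕ) {u v : ℕ × ℕ} (hu : u.1 < n ∧ u.2 < n)
    (hv : v.1 < n ∧ v.2 < n) (m t : ℤ) :
    ⁅HM n r e lam i m, SSM n r u v t⁆ = ((pr i u + pr i v : ℤ) : ℂ) • SSM n r u v (m + t) := by
  rw [lie_SSM (α := pr i u) (β := pr i v) (α₀ := 0) (β₀ := 0) (u' := u) (v' := v) m t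
    (fun q => by rw [lie_H_s _ _ _ hu, ite_self, zero_smul, zero_add])
    (fun q => by rw [lie_H_s _ _ _ hv, ite_self, zero_smul, zero_add])]
  push_cast
  module

theorem lie_b_P {u v : ℕ × ℕ} (h : u.2 ≤ v.2) (i : ℕ) (m t : ℤ) :
    ⁅bM n e lam i m, PM n r u v t⁆ = 0 := by
  rw [← lie_skew, lie_P_b h, neg_zero]

theorem lie_H_P (i : ℕ) {u v : ℕ × ℕ} (hu : u.1 < n ∧ u.2 < n) (hv : v.1 < n ∧ v.2 < n)
    (huv : u.2 ≤ v.2) (hne : u ≠ v) (m t : ℤ) :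
    ⁅HM n r e lam i m, PM n r u v t⁆ = ((pr i v - pr i u : ℤ) : ℂ) • PM n r u v (m + t) := by
  rw [HM, add_lie, lie_D_P _ hu hv huv hne, lie_b_P _ _ huv, add_zero]

theorem lie_H_P_self (i : ℕ) {u : ℕ × ℕ} (hu : u.1 < n ∧ u.2 < n) (m t : ℤ) :
    ⁅HM n r e lam i m, PM n r u u t⁆ =
      (if m + t = 0 ∧ u.2 + 1 ≤ r then -(m : ℂ) * pr i u else 0) • 1 := by
  rw [HM, add_lie, lie_D_P_self _ hu, lie_b_P _ _ le_rfl, add_zero]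

theorem sum_pr (i b : ℕ) : ∑ k ∈ Finset.range (b + 1), (pr i (k, b) : ℂ) =
    (if i = b then (b : ℂ) + 2 else 0) - if i = b + 1 then (b : ℂ) + 1 else 0 := by
  have h : ∀ k ∈ Finset.range (b + 1), (pr i (k, b) : ℂ) = (if i = k then 1 else 0)
      + (if i = b then 1 else 0) - (if i + 1 = k then 1 else 0) - (if i = b + 1 then 1 else 0) := by
    intro k hk
    have : k ≤ b := Nat.lt_succ_iff.1 (Finset.mem_range.1 hk)
    simp only [pr, this, if_true]
    push_cast
    rfl
  rw [Finset.sum_congr rfl h]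
  simp only [Finset.sum_add_distrib, Finset.sum_sub_distrib, Finset.sum_ite_eq, Finset.sum_const,
    Finset.mem_range, Finset.card_range, nsmul_eq_mul]
  rcases lt_trichotomy i b with h | rfl | h
  · simp [h.ne, Nat.lt_succ_of_lt h, h, show i ≠ b + 1 by omega]
  · simp
    ring
  · by_cases h' : i = b + 1
    · simp [h']
    · simp [h', h.ne', show ¬ (i < b + 1) by omega, show ¬ (i < b) by omega]

theorem sum_lie_H_P_self (i : ℕ) {b : ℕ} (hb : b < n) (m t : ℤ) :
    ∑ k ∈ Finset.range (b + 1), ⁅HM n r e lam i m, PM n r (k, b) (k, b) t⁆ =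
      (if m + t = 0 ∧ b + 1 ≤ r then -(m : ℂ) * ((if i = b then (b : ℂ) + 2 else 0)
        - if i = b + 1 then (b : ℂ) + 1 else 0) else 0) • (1 : Module.End ℂ (Fock n)) := by
  rw [Finset.sum_congr rfl fun k hk => lie_H_P_self e lam i (u := (k, b))
    ⟨lt_of_lt_of_le (Finset.mem_range.1 hk) hb, hb⟩ m t, ← Finset.sum_smul, ← sum_pr]
  by_cases h : m + t = 0 ∧ b + 1 ≤ r
  · simp only [if_pos h, Finset.mul_sum]
  · simp only [if_neg h, Finset.sum_const_zero]

/-- The values of the bilinear form on the vectors defining the Heisenberg operators. -/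
def HeisenbergForm (r : ℕ) (γ : ℂ) (e : ℕ → Fin n → ℂ) : Prop :=
  ∀ i j, i < n → j < n → ∑ k, e i k * e j k = (pr i (j, j) : ℂ) *
    (γ ^ 2 - (if r < i + 1 ∧ r < j + 1 then (r : ℂ) + 1 else 0)
      + if i = r ∧ j = r then (r : ℂ) / 2 else 0)

variable {e}

theorem lie_H_Ht (he : HeisenbergForm r γ e) {i j : ℕ} (hi : i < n) (hj : j < n) (m t : ℤ) :
    ⁅HM n r e lam i m, HtM n r e lam j t⁆ =
      (if m + t = 0 then -(pr i (j, j) : ℂ) * kap r γ j * m else 0) • 1 := by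
  have h1 : ∑ k ∈ Finset.range j, ⁅HM n r e lam i m, PM n r (k, j - 1) (k, j - 1) t⁆ =
      (if m + t = 0 ∧ j ≤ r then -(m : ℂ) * ((if i + 1 = j then (j : ℂ) + 1 else 0)
        - if i = j then (j : ℂ) else 0) else 0) • (1 : Module.End ℂ (Fock n)) := by
    rcases j with _ | j
    · simp
    · rw [add_tsub_cancel_right, sum_lie_H_P_self e lam i (by omega)]
      simp only [Nat.add_right_cancel_iff]
      push_cast
      ring_nf
  have h2 : ⁅HM n r e lam i m, bM n e lam j t⁆ =
      (if m + t = 0 then m * ∑ k, e i k * e j k else 0) • 1 := by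
    rw [HM, add_lie, lie_D_b, lie_b_b, zero_add]
  simp only [HtM, lie_add, lie_neg, lie_sum, h1, sum_lie_H_P_self e lam i hj, h2,
    lie_H_P_self e lam i (u := (j, j)) ⟨hj, hj⟩, he i j hi hj, ← neg_smul, ← add_smul]
  congr 1
  by_cases h : m + t = 0
  swap
  · simp [h]
  simp only [h, true_and, if_true, kap]
  have hp : pr i (j, j) = if i = j then 2 else if i + 1 = j ∨ i = j + 1 then -1 else 0 := by
    simp only [pr]
    split_ifs <;> omega
  rw [hp]
  have c0 (a : ℕ) : ¬ (a + 1 + 1 = a) ∧ ¬ (a = a + 1 + 1) := by omega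
  rcases lt_trichotomy j r with hr | rfl | hr
  · have hr' := hr.ne
    have hr1 := Nat.succ_le_of_lt hr
    by_cases c1 : i = j
    · subst c1
      simp [hr.le, hr1, hr', not_le.2 hr]
      ring
    by_cases c2 : i + 1 = j
    · subst c2
      simp [hr.le, hr1, hr', not_le.2 hr, c0]
      ring
    by_cases c3 : i = j + 1
    · subst c3
      simp [hr.le, hr1, hr', not_le.2 hr, c0]
      ring
    · simp [c1, c2, c3]
  · by_cases c1 : i = j
    · subst c1
      simp
      ring
    by_cases c2 : i + 1 = j
    · subst c2
      simp
      ring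
    by_cases c3 : i = j + 1
    · subst c3
      simp [c0]
      ring
    · simp [c1, c2, c3]
  · have hr' := hr.ne'
    have hr1 := Nat.lt_succ_of_lt hr
    have hr2 : ¬ (j + 1 ≤ r) := by omega
    by_cases c1 : i = j
    · subst c1
      simp [hr1, hr', not_le.2 hr, hr2]
      ring
    by_cases c2 : i + 1 = j
    · subst c2
      simp [hr1, hr', not_le.2 hr, hr2, hr]
      ring
    by_cases c3 : i = j + 1
    · subst c3
      simp [hr', not_le.2 hr, hr2, hr1, show r < j + 1 + 1 by omega]
      ring
    · simp [c1, c2, c3]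

end CartanRelations

section HERelation

variable {n r : ℕ} (γ : ℂ) {e : ℕ → Fin n → ℂ} (lam : ℕ → ℂ)

theorem lie_HE_s (i : ℕ) {j k l : ℕ} (hj : j < n) (hk : k < n) (hl : l < n) (m t q : ℤ) :
    ⁅⁅HM n r e lam i m, EM n r γ e lam j t⁆, sM n r (k, l) q⁆ =
      ⁅(pr i (j, j) : ℂ) • EM n r γ e lam j (m + t), sM n r (k, l) q⁆ := by
  have e1 : m + (t + q) = m + t + q := by ring
  have e2 : t + (m + q) = m + t + q := by ring
  rw [lie_lie_eq, lie_H_s e lam i (w := (k, l)) ⟨hk, hl⟩, lie_smul, smul_lie]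
  simp only [lie_E_s γ e lam hk hl]
  by_cases c1 : k < j ∧ j - 1 = l
  · obtain ⟨c1, rfl⟩ := c1
    simp only [c1, true_and, if_true, show ¬(j = j - 1) by omega, and_false, if_false,
      show ¬(j + 1 = k) by omega, sub_zero, add_zero, lie_sub,
      lie_H_SS e lam i (u := (j, j)) (v := (k, j - 1)) ⟨hj, hj⟩ ⟨hk, hl⟩,
      lie_H_s e lam i (w := (k, j)) ⟨hk, hj⟩, pr_add_right i c1, e1, e2]
    push_cast
    module
  by_cases c2 : k < j + 1 ∧ j = l
  · obtain ⟨c2, rfl⟩ := c2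
    simp only [c1, c2, if_false, if_true, and_true, show ¬(j + 1 = k) by omega, and_false,
      lie_neg, zero_sub, add_zero,
      lie_H_SS e lam i (u := (j, j)) (v := (k, j)) ⟨hj, hj⟩ ⟨hk, hl⟩, e1, e2]
    push_cast
    module
  by_cases c3 : (j + 1 ≤ l ∧ l < n) ∧ j + 1 = k
  · obtain ⟨⟨c3, -⟩, rfl⟩ := c3
    simp only [if_neg c1, if_neg c2, c3, hl, and_self, if_true, sub_zero, zero_add,
      lie_H_s e lam i (w := (j, l)) ⟨hj, hl⟩, pr_add_left i c3, e1, e2]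
    push_cast
    module
  · simp only [if_neg c1, if_neg c2, if_neg c3, sub_zero, add_zero, lie_zero, smul_zero]

theorem lie_HE_a (he : HeisenbergForm r γ e) {i j k l : ℕ} (hi : i < n) (hj : j < n) (hk : k < n)
    (hl : l < n) (m t q : ℤ) :
    ⁅⁅HM n r e lam i m, EM n r γ e lam j t⁆, aM n r (k, l) q⁆ =
      ⁅(pr i (j, j) : ℂ) • EM n r γ e lam j (m + t), aM n r (k, l) q⁆ := by
  have e1 : m + (t + q) = m + t + q := by ring
  have e2 : t + (m + q) = m + t + q := by ring
  rw [lie_lie_eq, lie_H_a e lam i (w := (k, l)) ⟨hk, hl⟩, lie_smul, smul_lie]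
  simp only [lie_E_a γ e lam hk hl]
  by_cases c1 : k < j ∧ j - 1 = l
  · obtain ⟨c1, rfl⟩ := c1
    simp only [c1, true_and, if_true, show ¬(j = j - 1) by omega, and_false, if_false,
      show ¬(j = k) by omega, add_zero, lie_neg,
      lie_H_P e lam i (u := (k, j - 1)) (v := (j, j)) ⟨hk, hl⟩ ⟨hj, hj⟩ (by simp)
        (by simp; omega), e1, e2]
    push_cast
    module
  by_cases c2 : k < j ∧ j = l
  · obtain ⟨c2, rfl⟩ := c2
    have c3 : (k, j) ≠ (j, j) := by
      simp only [ne_eq, Prod.mk.injEq]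
      omega
    simp only [c2, if_true, if_false, and_true, show ¬(j = k) by omega, and_false,
      show ¬(j - 1 = j) by omega, zero_add, add_zero, lie_add,
      lie_H_a e lam i (w := (k, j - 1)) ⟨hk, by simp only; omega⟩, pr_add_right i c2,
      lie_H_P e lam i (u := (k, j)) (v := (j, j)) ⟨hk, hl⟩ ⟨hj, hj⟩ le_rfl c3, e1, e2]
    push_cast
    module
  by_cases c3 : (j + 1 ≤ l ∧ l < n) ∧ j = k
  · obtain ⟨⟨c3, -⟩, rfl⟩ := c3
    simp only [c3, hl, show ¬(j = l) by omega, and_self, and_false,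
      if_false, if_true, zero_add, add_zero, lie_neg, lt_irrefl, false_and, pr_add_left i c3,
      lie_H_a e lam i (w := (j + 1, l)) ⟨by simp only; omega, hl⟩, e1, e2]
    push_cast
    module
  by_cases c4 : j = k ∧ j = l
  · obtain ⟨rfl, rfl⟩ := c4
    simp only [lt_irrefl, false_and, if_false, if_true, and_self, show ¬(j + 1 ≤ j) by omega,
      zero_add, lie_sub, lie_smul, lie_one_eq, smul_zero, sub_zero, lie_H_Ht γ lam he hi hj, e1, e2]
    by_cases h : m + t + q = 0
    · simp only [h, if_true]
      push_cast
      module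
    · simp only [h, if_false]
      module
  · simp only [if_neg c1, if_neg c2, if_neg c3, if_neg c4, add_zero, lie_zero, smul_zero, sub_zero]

theorem lie_H_E (he : HeisenbergForm r γ e) {i j : ℕ} (hi : i < n) (hj : j < n) (m t : ℤ) :
    ⁅HM n r e lam i m, EM n r γ e lam j t⁆ = (pr i (j, j) : ℂ) • EM n r γ e lam j (m + t) := by
  rw [← sub_eq_zero]
  refine eq_zero_of_lie_eq_zero (r := r) one_ne_zero
    (lie_K_sub ?_ (lie_K_smul (lie_K_E γ e lam hj (m + t)))) (fun w h1 h2 q => ?_)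
    (fun w h1 h2 q => ?_) (fun k q => ?_)
  · simpa using lie_K_lie (lie_K_H e lam i m) (lie_K_E γ e lam hj t)
  · rw [sub_lie, sub_eq_zero]
    exact lie_HE_a γ lam he hi hj h1 h2 m t q
  · rw [sub_lie, sub_eq_zero]
    exact lie_HE_s γ lam i hj h1 h2 m t q
  · have e1 : m + (t + q) = m + t + q := by ring
    rw [sub_lie, lie_lie_eq, lie_H_y, lie_smul, lie_one_eq, smul_zero, sub_zero, lie_E_y, lie_smul,
      lie_H_s e lam i (w := (j, j)) ⟨hj, hj⟩, smul_lie, lie_E_y, smul_comm, e1, sub_self]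

end HERelation

section Bicommutant

variable {n r : ℕ}

/-- Membership in the bicommutant of the operators `a*_{kl,m}`. -/
def InA (r : ℕ) (T : Module.End ℂ (Fock n)) : Prop :=
  ∀ X : Module.End ℂ (Fock n),
    (∀ w : ℕ × ℕ, w.1 < n → w.2 < n → ∀ q, ⁅X, sM n r w q⁆ = 0) → ⁅X, T⁆ = 0

theorem InA.add {S T : Module.End ℂ (Fock n)} (hS : InA r S) (hT : InA r T) : InA r (S + T) :=
  fun X hX => by rw [lie_add, hS X hX, hT X hX, add_zero]

theorem InA.sub {S T : Module.End ℂ (Fock n)} (hS : InA r S) (hT : InA r T) : InA r (S - T) :=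
  fun X hX => by rw [lie_sub, hS X hX, hT X hX, sub_zero]

theorem InA.smul {T : Module.End ℂ (Fock n)} (c : ℂ) (hT : InA r T) : InA r (c • T) :=
  fun X hX => by rw [lie_smul, hT X hX, smul_zero]

theorem inA_zero : InA r (0 : Module.End ℂ (Fock n)) := fun _ _ => lie_zero _

theorem inA_s {w : ℕ × ℕ} (h1 : w.1 < n) (h2 : w.2 < n) (q : ℤ) : InA r (sM n r w q) :=
  fun _ hX => hX w h1 h2 q

theorem inA_SS {u v : ℕ × ℕ} (hu : u.1 < n ∧ u.2 < n) (hv : v.1 < n ∧ v.2 < n) (m : ℤ) :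
    InA r (SSM n r u v m) := fun X hX => by
  rw [SSM, lie_LSum (locFin_SS u v m)]
  simp only [lie_mul_eq, hX u hu.1 hu.2, hX v hv.1 hv.2, zero_mul, mul_zero, add_zero, LSum_zero]

theorem InA.lie_s {T : Module.End ℂ (Fock n)} (hT : InA r T) (w : ℕ × ℕ) (q : ℤ) :
    ⁅T, sM n r w q⁆ = 0 := by
  rw [← lie_skew, hT _ fun _ _ _ _ => lie_s_s _ _ _ _, neg_zero]

theorem InA.lie_y {T : Module.End ℂ (Fock n)} (hT : InA r T) (k : Fin n) (q : ℤ) :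
    ⁅T, yM n k q⁆ = 0 := by
  rw [← lie_skew, hT _ fun _ _ _ _ => by rw [← lie_skew, lie_s_y, neg_zero], neg_zero]

/-- Operators acting on the bicommutant of the `a*_{kl,m}` by derivations and not involving the
oscillators outside of the positive roots. -/
structure IsRaising (r : ℕ) (T : Module.End ℂ (Fock n)) : Prop where
  s : ∀ w : ℕ × ℕ, w.1 < n → w.2 < n → ∀ q, InA r ⁅T, sM n r w q⁆
  y : ∀ k q, InA r ⁅T, yM n k q⁆
  a_of_lt : ∀ w : ℕ × ℕ, w.1 < n → w.2 < w.1 → ∀ q, ⁅T, aM n r w q⁆ = 0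
  s_of_lt : ∀ w : ℕ × ℕ, w.1 < n → w.2 < w.1 → ∀ q, ⁅T, sM n r w q⁆ = 0

theorem IsRaising.lie_inA {T B : Module.End ℂ (Fock n)} (hT : IsRaising r T) (hB : InA r B) :
    InA r ⁅T, B⁆ := fun X hX => by
  have h : ⁅⁅X, T⁆, B⁆ = 0 := hB _ fun w h1 h2 q => by
    rw [lie_lie_eq, hT.s w h1 h2 q X hX, hX w h1 h2, lie_zero, sub_zero]
  rw [leibniz_lie, h, hB X hX, lie_zero, add_zero]

theorem IsRaising.lie {S T : Module.End ℂ (Fock n)} (hS : IsRaising r S) (hT : IsRaising r T) :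
    IsRaising r ⁅S, T⁆ where
  s w h1 h2 q := by
    rw [lie_lie_eq]
    exact (hS.lie_inA (hT.s w h1 h2 q)).sub (hT.lie_inA (hS.s w h1 h2 q))
  y k q := by
    rw [lie_lie_eq]
    exact (hS.lie_inA (hT.y k q)).sub (hT.lie_inA (hS.y k q))
  a_of_lt w h1 h2 q := by
    rw [lie_lie_eq, hS.a_of_lt w h1 h2, hT.a_of_lt w h1 h2, lie_zero, lie_zero, sub_zero]
  s_of_lt w h1 h2 q := by
    rw [lie_lie_eq, hS.s_of_lt w h1 h2, hT.s_of_lt w h1 h2, lie_zero, lie_zero, sub_zero]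

theorem IsRaising.sub {S T : Module.End ℂ (Fock n)} (hS : IsRaising r S) (hT : IsRaising r T) :
    IsRaising r (S - T) where
  s w h1 h2 q := by
    rw [sub_lie]
    exact (hS.s w h1 h2 q).sub (hT.s w h1 h2 q)
  y k q := by
    rw [sub_lie]
    exact (hS.y k q).sub (hT.y k q)
  a_of_lt w h1 h2 q := by rw [sub_lie, hS.a_of_lt w h1 h2, hT.a_of_lt w h1 h2, sub_zero]
  s_of_lt w h1 h2 q := by rw [sub_lie, hS.s_of_lt w h1 h2, hT.s_of_lt w h1 h2, sub_zero]

theorem isRaising_E (γ : ℂ) (e : ℕ → Fin n → ℂ) (lam : ℕ → ℂ) {i : ℕ} (hi : i < n) (m : ℤ) :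
    IsRaising r (EM n r γ e lam i m) where
  s w h1 h2 q := by
    obtain ⟨k, l⟩ := w
    have hpred : i - 1 < n := by omega
    rw [lie_E_s γ e lam h1 h2]
    refine InA.add (InA.sub ?_ ?_) ?_
    · split_ifs
      · exact (inA_SS (u := (i, i)) (v := (k, i - 1)) ⟨hi, hi⟩ ⟨h1, hpred⟩ _).sub
          (inA_s (w := (k, i)) h1 hi _)
      · exact inA_zero
    · split_ifs
      · exact inA_SS (u := (i, i)) (v := (k, i)) ⟨hi, hi⟩ ⟨h1, hi⟩ _
      · exact inA_zero
    · split_ifs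
      · exact inA_s (w := (i, l)) hi h2 _
      · exact inA_zero
  y k q := by
    rw [lie_E_y]
    exact (inA_s (w := (i, i)) hi hi _).smul _
  a_of_lt w h1 h2 q := by
    obtain ⟨k, l⟩ := w
    simp only at h1 h2
    rw [lie_E_a γ e lam h1 (by omega), if_neg (by omega), if_neg (by omega), if_neg (by omega),
      if_neg (by omega)]
    simp only [add_zero]
  s_of_lt w h1 h2 q := by
    obtain ⟨k, l⟩ := w
    simp only at h1 h2
    rw [lie_E_s γ e lam h1 (by omega), if_neg (by omega), if_neg (by omega), if_neg (by omega)]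
    simp only [add_zero, sub_zero]

/-- An operator of nonzero height that commutes with all `a*_{kl,m}`, `y_{k,m}` and `F_{k,m}`
vanishes. -/
theorem eq_zero_of_lie_F {U : Module.End ℂ (Fock n)} {c : ℂ} (hc : c ≠ 0)
    (hK : ⁅KM n r, U⁆ = c • U)
    (hs : ∀ w : ℕ × ℕ, w.1 < n → w.2 < n → ∀ q, ⁅U, sM n r w q⁆ = 0)
    (hy : ∀ k q, ⁅U, yM n k q⁆ = 0)
    (hF : ∀ k < n, ∀ t, ⁅U, FM n r k t⁆ = 0)
    (ha : ∀ w : ℕ × ℕ, w.1 < n → w.2 < w.1 → ∀ q, ⁅U, aM n r w q⁆ = 0) : U = 0 := by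
  have key : ∀ d l, n ≤ l + d → l < n → ∀ k < n, ∀ q, ⁅U, aM n r (k, l) q⁆ = 0 := by
    intro d
    induction d with
    | zero => intro l h1 h2; omega
    | succ d ih =>
      intro l hd hl
      have hll : ∀ q, ⁅U, aM n r (l, l) q⁆ = 0 := fun q => by
        have hP : ∀ x ∈ Finset.Ico (l + 1) n, ⁅U, PM n r (l, x) (l + 1, x) q⁆ = 0 := fun x hx => by
          rw [Finset.mem_Ico] at hx
          rw [lie_PM (u := (l, x)) (v := (l + 1, x)) (u' := (l, x)) (v' := (l + 1, x))
            (α := 0) (β := 0) (β₀ := 0) 0 q le_rfl le_rfl le_rfl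
            (fun q => by rw [ih x (by omega) hx.2 l hl, zero_smul])
            (fun q => by
              rw [hs (l + 1, x) (by simp only; omega) hx.2, ite_self, zero_smul, zero_smul,
                add_zero])
            (Or.inl rfl) (Or.inl rfl)]
          simp only [zero_smul, add_zero]
        have h := hF l hl q
        rwa [FM, lie_add, lie_sum, Finset.sum_eq_zero hP, add_zero] at h
      have hk : ∀ d' k, l ≤ k + d' → k < n → ∀ q, ⁅U, aM n r (k, l) q⁆ = 0 := by
        intro d'
        induction d' with
        | zero =>
          intro k h1 h2 q
          rcases (show l ≤ k from h1).eq_or_lt with rfl | h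
          · exact hll q
          · exact ha _ h2 h q
        | succ d' ih' =>
          intro k h1 h2 q
          by_cases h : l ≤ k + d'
          · exact ih' k h h2 q
          have h3 := lie_F_a (r := r) (i := k) (k := k + 1) (show k + 1 < n by omega) hl 0 q
          rw [if_pos ⟨⟨by omega, hl⟩, rfl⟩, zero_add] at h3
          rw [← neg_neg (aM n r (k, l) q), ← h3, lie_neg, leibniz_lie, hF k h2,
            ih' (k + 1) (by omega) (by omega), lie_zero, zero_lie, add_zero, neg_zero]
      exact fun k hkn q => hk l k (by omega) hkn q
  exact eq_zero_of_lie_eq_zero hc hK (fun w h1 h2 q => key n w.2 (by omega) h2 w.1 h1 q) hs hy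

/-- A raising operator of positive height that commutes with all `F_{k,m}` vanishes. -/
theorem IsRaising.eq_zero {T : Module.End ℂ (Fock n)} (hT : IsRaising r T) {w : ℕ} (hw : w ≠ 0)
    (hK : ⁅KM n r, T⁆ = (w : ℂ) • T) (hF : ∀ k < n, ∀ t, ⁅T, FM n r k t⁆ = 0) : T = 0 := by
  have hs : ∀ d k l, k + d = l → l < n → ∀ q, ⁅T, sM n r (k, l) q⁆ = 0 := by
    intro d
    induction d with
    | zero =>
      intro k l h hl q
      obtain rfl : k = l := h
      have hin := hT.s (k, k) hl hl q
      refine eq_zero_of_lie_F (c := (w : ℂ) + 1) (by exact_mod_cast Nat.succ_ne_zero w)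
        ?_ (fun w _ _ t => hin.lie_s w t) hin.lie_y (fun j hj t => ?_) fun u h1 h2 t => ?_
      · refine lie_K_lie hK ?_
        rw [lie_K_s ⟨hl, hl⟩]
        simp [ht]
      · rw [lie_lie_eq, hF j hj, lie_zero, sub_zero,
          ← lie_skew (sM n r (k, k) q) (FM n r j t), lie_F_s hl hl,
          if_neg (show ¬((j + 1 ≤ k ∧ k < n) ∧ j = k) by omega), add_zero, lie_neg, lie_smul,
          lie_one_eq, smul_zero, neg_zero]
      · rw [lie_lie_eq, hT.a_of_lt u h1 h2, lie_zero, sub_zero,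
          lie_s_a _ _ ⟨h1, by omega⟩, lie_smul, lie_one_eq, smul_zero]
    | succ d ih =>
      intro k l h hl q
      have hk : k < n := by omega
      have hin := hT.s (k, l) hk hl q
      refine eq_zero_of_lie_F (c := (w : ℂ) + (d + 2)) (by
          exact_mod_cast (show w + (d + 2) ≠ 0 by omega))
        ?_ (fun w _ _ t => hin.lie_s w t) hin.lie_y (fun j hj t => ?_) fun u h1 h2 t => ?_
      · refine lie_K_lie hK ?_
        rw [lie_K_s ⟨hk, hl⟩, show ht (k, l) = d + 2 by simp only [ht]; omega]
        push_cast
        rfl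
      · rw [lie_lie_eq, hF j hj, lie_zero, sub_zero,
          ← lie_skew (sM n r (k, l) q) (FM n r j t), lie_F_s hk hl,
          lie_neg, lie_add, lie_smul, lie_one_eq, smul_zero, zero_add]
        split_ifs with h
        · rw [ih (j + 1) l (by omega) hl, neg_zero]
        · rw [lie_zero, neg_zero]
      · rw [lie_lie_eq, hT.a_of_lt u h1 h2, lie_zero, sub_zero,
          lie_s_a _ _ ⟨h1, by omega⟩, lie_smul, lie_one_eq, smul_zero]
  have hw' : (w : ℂ) ≠ 0 := by exact_mod_cast hw
  refine eq_zero_of_lie_F hw' hK (fun u h1 h2 q => ?_) (fun k q => ?_) hF hT.a_of_lt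
  · by_cases h : u.1 ≤ u.2
    · exact hs (u.2 - u.1) u.1 u.2 (by omega) h2 q
    · exact hT.s_of_lt u h1 (by omega) q
  · have hin := hT.y k q
    refine eq_zero_of_lie_F (c := (w : ℂ) + 0) (by rwa [add_zero])
        (lie_K_lie hK (by rw [lie_K_y, zero_smul])) (fun w _ _ t => hin.lie_s w t) hin.lie_y
        (fun j hj t => ?_) fun u h1 h2 t => ?_
    · rw [lie_lie_eq, hF j hj, lie_zero, sub_zero,
        ← lie_skew (yM n k q) (FM n r j t), lie_F_y, neg_zero, lie_zero]
    · rw [lie_lie_eq, hT.a_of_lt u h1 h2, lie_zero, sub_zero,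
        ← lie_skew (yM n k q) (aM n r u t), lie_a_y, neg_zero, lie_zero]

end Bicommutant

section Serre

variable {n r : ℕ} (γ : ℂ) {e : ℕ → Fin n → ℂ} (lam : ℕ → ℂ)

theorem lie_lie_E_E_F (he : HeisenbergForm r γ e) {i j : ℕ} (hi : i < n) (hj : j < n) (k : ℕ)
    (m p t : ℤ) : ⁅⁅EM n r γ e lam i m, EM n r γ e lam j p⁆, FM n r k t⁆ =
      (if i = k then (pr i (j, j) : ℂ) • EM n r γ e lam j (m + p + t) else 0)
      - if j = k then (pr j (i, i) : ℂ) • EM n r γ e lam i (m + p + t) else 0 := by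
  have h1 {i j : ℕ} (hi : i < n) (hj : j < n) (m p : ℤ) :
      ⁅EM n r γ e lam j p, ⁅EM n r γ e lam i m, FM n r k t⁆⁆ =
      -if i = k then (pr i (j, j) : ℂ) • EM n r γ e lam j (m + p + t) else 0 := by
    rw [← lie_skew]
    split_ifs with h
    · subst h
      rw [lie_lie_E_F_self γ e lam hi, lie_H_E γ lam he hi hj]
      congr 3
      ring
    · rw [lie_lie_E_F_ne γ e lam hi h]
  rw [lie_lie_eq, h1 hi hj, h1 hj hi, add_comm p m]
  abel

theorem lie_E_E_eq (he : HeisenbergForm r γ e) {i j : ℕ} (hi : i < n) (hj : j < n)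
    {m p m' p' : ℤ} (h : m + p = m' + p') :
    ⁅EM n r γ e lam i m, EM n r γ e lam j p⁆ = ⁅EM n r γ e lam i m', EM n r γ e lam j p'⁆ := by
  have hE {i : ℕ} (hi : i < n) (m : ℤ) := isRaising_E (r := r) γ e lam hi m
  rw [← sub_eq_zero]
  refine (((hE hi m).lie (hE hj p)).sub ((hE hi m').lie (hE hj p'))).eq_zero two_ne_zero ?_
    fun k _ t => ?_
  · have hK (m p : ℤ) := lie_K_lie (lie_K_E (r := r) γ e lam hi m) (lie_K_E γ e lam hj p)
    norm_num at hK ⊢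
    rw [hK, hK, smul_sub]
  · rw [sub_lie, lie_lie_E_E_F γ lam he hi hj, lie_lie_E_E_F γ lam he hi hj, h, sub_self]

theorem lie_E_E_self (he : HeisenbergForm r γ e) {i : ℕ} (hi : i < n) (m p : ℤ) :
    ⁅EM n r γ e lam i m, EM n r γ e lam i p⁆ = 0 := by
  have h : ⁅EM n r γ e lam i m, EM n r γ e lam i p⁆ =
      -⁅EM n r γ e lam i m, EM n r γ e lam i p⁆ := by
    conv_rhs => rw [lie_skew]
    exact lie_E_E_eq γ lam he hi hi (add_comm m p)
  have h2 : (2 : ℂ) • ⁅EM n r γ e lam i m, EM n r γ e lam i p⁆ = 0 := by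
    rw [two_smul]
    exact add_eq_zero_iff_eq_neg.2 h
  exact (smul_eq_zero.1 h2).resolve_left two_ne_zero

theorem pr_self (i : ℕ) : pr i (i, i) = 2 := by
  simp only [pr]
  split_ifs <;> omega

theorem pr_adjacent {i j : ℕ} (h : i + 1 = j ∨ j + 1 = i) : pr i (j, j) = -1 := by
  simp only [pr]
  split_ifs <;> omega

theorem serre_E (he : HeisenbergForm r γ e) {i j : ℕ} (hi : i < n) (hj : j < n)
    (hij : i + 1 = j ∨ j + 1 = i) (a b p : ℤ) :
    ⁅EM n r γ e lam i a, ⁅EM n r γ e lam i b, EM n r γ e lam j p⁆⁆ = 0 := by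
  have hE {i : ℕ} (hi : i < n) (m : ℤ) := isRaising_E (r := r) γ e lam hi m
  refine ((hE hi a).lie ((hE hi b).lie (hE hj p))).eq_zero three_ne_zero ?_ fun k _ t => ?_
  · have hK := lie_K_lie (lie_K_E (r := r) γ e lam hi a)
      (lie_K_lie (lie_K_E γ e lam hi b) (lie_K_E γ e lam hj p))
    norm_num at hK ⊢
    exact hK
  · rw [lie_lie_eq, lie_lie_E_E_F γ lam he hi hj,
      ← lie_skew ⁅EM n r γ e lam i b, EM n r γ e lam j p⁆ ⁅EM n r γ e lam i a, FM n r k t⁆]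
    by_cases h : i = k
    · subst h
      rw [if_pos rfl, if_neg (by omega), lie_lie_E_F_self γ e lam hi, leibniz_lie,
        lie_H_E γ lam he hi hi, lie_H_E γ lam he hi hj, smul_lie, lie_smul, sub_zero, lie_smul,
        pr_self, pr_adjacent hij,
        lie_E_E_eq γ lam he hi hj (show a + (b + p + t) = a + t + b + p by ring),
        lie_E_E_eq γ lam he hi hj (show b + (a + t + p) = a + t + b + p by ring)]
      push_cast
      module
    · rw [if_neg h, lie_lie_E_F_ne γ e lam hi h, neg_zero, sub_zero]
      split_ifs
      · rw [zero_sub, lie_neg, lie_smul, lie_E_E_self γ lam he hi, smul_zero, neg_zero]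
      · rw [sub_zero, lie_zero]

theorem lie_F_F_F_s {a b c k l : ℕ} (hk : k < n) (hl : l < n)
    (h : b ≠ a + 1 ∨ c ≠ b + 1) (x y z q : ℤ) :
    ⁅FM n r c x, ⁅FM n r b y, ⁅FM n r a z, sM n r (k, l) q⁆⁆⁆ = 0 := by
  rw [lie_F_s hk hl, lie_add, lie_smul, lie_one_eq, smul_zero, zero_add]
  split_ifs with h1
  · rw [lie_F_s (by omega) hl, lie_add, lie_smul, lie_one_eq, smul_zero, zero_add]
    split_ifs with h2
    · rw [lie_F_s (by omega) hl, if_neg (by omega), if_neg (by omega), zero_smul, add_zero]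
    · rw [lie_zero]
  · rw [lie_zero, lie_zero]

theorem lie_F_F_F_a {a b c k l : ℕ} (hk : k < n) (hl : l < n)
    (h : b + 1 ≠ a ∨ c + 1 ≠ b) (x y z q : ℤ) :
    ⁅FM n r c x, ⁅FM n r b y, ⁅FM n r a z, aM n r (k, l) q⁆⁆⁆ = 0 := by
  rw [lie_F_a hk hl]
  split_ifs with h1
  · rw [lie_neg, lie_F_a (by omega) hl]
    split_ifs with h2
    · rw [neg_neg, lie_F_a (by omega) hl, if_neg (by omega)]
    · rw [neg_zero, lie_zero]
  · rw [lie_zero, lie_zero]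

theorem serre_F {i j : ℕ} (hi : i < n) (hj : j < n) (a b p : ℤ) :
    ⁅FM n r i a, ⁅FM n r i b, FM n r j p⁆⁆ = 0 := by
  refine eq_zero_of_lie_eq_zero (r := r) (c := -1 + (-1 + -1)) (by norm_num)
    (lie_K_lie (lie_K_F hi a) (lie_K_lie (lie_K_F hi b) (lie_K_F hj p)))
    (fun w h1 h2 q => ?_) (fun w h1 h2 q => ?_) fun k q => ?_
  · simp only [lie_lie_eq, lie_sub]
    rw [lie_F_F_F_a h1 h2 (by omega), lie_F_F_F_a h1 h2 (by omega), lie_F_F_F_a h1 h2 (by omega),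
      lie_F_F_F_a h1 h2 (by omega)]
    simp only [sub_zero]
  · simp only [lie_lie_eq, lie_sub]
    rw [lie_F_F_F_s h1 h2 (by omega), lie_F_F_F_s h1 h2 (by omega), lie_F_F_F_s h1 h2 (by omega),
      lie_F_F_F_s h1 h2 (by omega)]
    simp only [sub_zero]
  · simp only [lie_lie_eq, lie_F_y, lie_zero, sub_zero]

end Serre

section FockModes

variable {n r : ℕ}

theorem aM_apply (k l : Fin n) (q : ℤ) (P : Fock n) : aM n r (k, l) q P = aOp n r k l q P := by
  rw [aM, dif_pos ⟨k.isLt, l.isLt⟩, aOp]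
  split_ifs <;> rfl

theorem sM_apply (k l : Fin n) (q : ℤ) (P : Fock n) : sM n r (k, l) q P = aStar n r k l q P := by
  rw [sM, dif_pos ⟨k.isLt, l.isLt⟩, aStar]
  split_ifs <;> rfl

theorem aF_eq (k l : Fin n) (q : ℤ) : aF n r (k, l) q = (aOp n r k l q, annAFlag r l q) :=
  Prod.ext (LinearMap.ext fun P => aM_apply k l q P) rfl

theorem sF_eq (k l : Fin n) (q : ℤ) : sF n r (k, l) q = (aStar n r k l q, annSFlag r l q) :=
  Prod.ext (LinearMap.ext fun P => sM_apply k l q P) rfl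

theorem PM_apply {k l k' l' : Fin n} (h : (k, l) ≠ (k', l')) (hl : l ≤ l') (m : ℤ) (P : Fock n) :
    PM n r (k, l) (k', l') m P = pairOp n r k l k' l' m P := by
  rw [PM, LSum_apply (locFin_P (u := (k, l)) (v := (k', l')) hl m)]
  refine finsum_congr fun q => ?_
  have h' : ((k : ℕ), (l : ℕ)) ≠ ((k' : ℕ), (l' : ℕ)) := fun hh =>
    h (Prod.ext (Fin.ext (Prod.ext_iff.1 hh).1) (Fin.ext (Prod.ext_iff.1 hh).2))
  rw [nord_a_s h', Module.End.mul_apply]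
  exact (aM_apply k l q _).trans (congrArg (aOp n r k l q) (sM_apply k' l' _ P))

theorem CM_apply (i k : Fin n) {l : Fin n} (hl : l ≤ i) (m : ℤ) (P : Fock n) :
    CM n r (i, i) (k, l) m P = cubic n r i k l m P := by
  rw [CM, LSum_apply (locFin_C (u := (k, l)) (v := (i, i)) hl m)]
  refine finsum_congr fun q => ?_
  rw [sF_eq, sF_eq, aF_eq]
  rfl

/-- Extension of a family indexed by `Fin n` by zero. -/
def extendFin {M : Type*} [Zero M] (f : Fin n → M) (i : ℕ) : M := if h : i < n then f ⟨i, h⟩ else 0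

theorem extendFin_coe {M : Type*} [Zero M] (f : Fin n → M) (i : Fin n) : extendFin f i = f i :=
  dif_pos i.isLt

theorem bM_apply (e : Fin n → Fin n → ℂ) (lam : Fin n → ℂ) (i : Fin n) (m : ℤ) (P : Fock n) :
    bM n (extendFin e) (extendFin lam) i m P = bOp n e lam i m P := by
  refine LinearMap.congr_fun (?_ : _ = (bOp n e lam i m : Module.End ℂ (Fock n))) P
  rw [bM, bOp, extendFin_coe, extendFin_coe]
  rcases lt_trichotomy m 0 with h | rfl | h
  · rw [if_neg h.ne, zero_smul, zero_add, dif_neg h.not_gt, dif_pos h]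
    refine Finset.sum_congr rfl fun k _ => ?_
    rw [yM, dif_neg h.not_gt, dif_pos h]
    rfl
  · rw [if_pos rfl, dif_neg (lt_irrefl _), dif_neg (lt_irrefl _)]
    simp only [yM, lt_irrefl, dif_neg, not_false_eq_true, smul_zero, Finset.sum_const_zero,
      add_zero]
    rfl
  · rw [if_neg h.ne', zero_smul, zero_add, dif_pos h]
    have : ∀ k, extendFin e i k • yM n k m = (m : ℂ) • e i k • der (Sum.inr (k, toPos m h)) :=
      fun k => by rw [extendFin_coe, yM, dif_pos h, smul_comm]
    simp only [extendFin_coe] at this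
    rw [Finset.sum_congr rfl fun k _ => this k, ← Finset.smul_sum]
    rfl

theorem BM_apply (e : Fin n → Fin n → ℂ) (lam : Fin n → ℂ) (i : Fin n) (m : ℤ) (P : Fock n) :
    BM n r (extendFin e) (extendFin lam) (i, i) i m P =
      ∑ᶠ q : ℤ, aStar n r i i q (bOp n e lam i (m - q) P) := by
  rw [BM, LSum_apply (locFin_B _ _ _ _ m)]
  refine finsum_congr fun q => ?_
  exact (sM_apply i i q _).trans (congrArg (aStar n r i i q) (bM_apply e lam i _ P))

theorem sum_fin_of_lt {M : Type*} [AddCommMonoid M] {i : ℕ} (hi : i ≤ n) (g : ℕ → M)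
    (f : Fin n → M) (h1 : ∀ k : Fin n, (k : ℕ) < i → f k = g k)
    (h2 : ∀ k : Fin n, i ≤ k → f k = 0) : ∑ k, f k = ∑ k ∈ Finset.range i, g k := by
  have h : ∀ k : Fin n, f k = if (k : ℕ) < i then g k else 0 := fun k => by
    split_ifs with h
    · exact h1 k h
    · exact h2 k (not_lt.1 h)
  rw [Finset.sum_congr rfl fun k _ => h k,
    Fin.sum_univ_eq_sum_range (fun k => if k < i then g k else 0) n, ← Finset.sum_filter]
  refine Finset.sum_congr (Finset.ext fun k => ?_) fun _ _ => rfl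
  simp only [Finset.mem_filter, Finset.mem_range]
  omega

theorem sum_fin_of_gt {M : Type*} [AddCommMonoid M] (i : ℕ) (g : ℕ → M)
    (f : Fin n → M) (h1 : ∀ k : Fin n, i < k → f k = g k)
    (h2 : ∀ k : Fin n, (k : ℕ) ≤ i → f k = 0) : ∑ k, f k = ∑ k ∈ Finset.Ico (i + 1) n, g k := by
  have h : ∀ k : Fin n, f k = if i < (k : ℕ) then g k else 0 := fun k => by
    split_ifs with h
    · exact h1 k h
    · exact h2 k (not_lt.1 h)
  rw [Finset.sum_congr rfl fun k _ => h k,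
    Fin.sum_univ_eq_sum_range (fun k => if i < k then g k else 0) n, ← Finset.sum_filter]
  refine Finset.sum_congr (Finset.ext fun k => ?_) fun _ _ => rfl
  simp only [Finset.mem_filter, Finset.mem_range, Finset.mem_Ico]
  omega

theorem FM_apply (i : Fin n) (m : ℤ) (P : Fock n) : FM n r i m P = rhoF n r i m P := by
  rw [FM, LinearMap.add_apply, LinearMap.sum_apply]
  refine congrArg₂ (fun A B : PXY n => A + B) (aM_apply i i m P)
    (sum_fin_of_gt (M := PXY n) i _ _ (fun k hk => ?_) fun k hk => dif_neg (not_lt.2 hk)).symm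
  have hk' : i < k := hk
  refine (dif_pos hk').trans (Eq.symm ?_)
  refine PM_apply (n := n) (k := i) (l := k) (k' := ⟨i + 1, by omega⟩) (l' := k) (fun h => ?_)
    le_rfl m P
  simpa using congrArg Fin.val (Prod.ext_iff.1 h).1

theorem EM_apply (γ : ℂ) (e : Fin n → Fin n → ℂ) (lam : Fin n → ℂ) (i : Fin n) (m : ℤ)
    (P : Fock n) :
    EM n r γ (extendFin e) (extendFin lam) i m P = rhoE n r γ e lam i m P := by
  have h1 : ∑ k ∈ Finset.range (i : ℕ), CM n r (i, i) (k, i - 1) m P =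
      (∑ k : Fin n, if h : k < i then
        cubic n r i k (⟨(i : ℕ) - 1, by have := i.isLt; omega⟩ : Fin n) m P else 0 : PXY n) := by
    refine (sum_fin_of_lt (M := PXY n) i.isLt.le _ _ (fun k hk => ?_)
      fun k hk => dif_neg (not_lt.2 hk)).symm
    exact (dif_pos hk).trans
      (CM_apply i k (l := ⟨(i : ℕ) - 1, by omega⟩) (Nat.sub_le _ _) m P).symm
  have h2 : ∑ k ∈ Finset.range ((i : ℕ) + 1), CM n r (i, i) (k, i) m P =
      (∑ k : Fin n, if k ≤ i then cubic n r i k i m P else 0 : PXY n) := by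
    refine (sum_fin_of_lt (M := PXY n) i.isLt _ _ (fun k hk => ?_)
      fun k hk => if_neg (not_le.2 hk)).symm
    exact (if_pos (Nat.lt_succ_iff.1 hk)).trans (CM_apply i k le_rfl m P).symm
  have h3 : ∑ l ∈ Finset.Ico ((i : ℕ) + 1) n, PM n r (i + 1, l) (i, l) m P =
      sumHigh n r i m P := by
    refine (sum_fin_of_gt (M := PXY n) i _ _ (fun k hk => ?_)
      fun k hk => dif_neg (not_lt.2 hk)).symm
    have hk' : i < k := hk
    refine (dif_pos hk').trans (Eq.symm ?_)
    refine PM_apply (n := n) (k := ⟨i + 1, by omega⟩) (l := k) (k' := i) (l' := k) (fun h => ?_)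
      le_rfl m P
    simpa using congrArg Fin.val (Prod.ext_iff.1 h).1
  have h4 : ∑ k ∈ Finset.range (i : ℕ), PM n r (k, i - 1) (k, i) m P = sumLow n r i m P := by
    refine (sum_fin_of_lt (M := PXY n) i.isLt.le _ _ (fun k hk => ?_)
      fun k hk => dif_neg (not_lt.2 hk)).symm
    refine (dif_pos hk).trans (Eq.symm ?_)
    refine PM_apply (n := n) (k := k) (l := ⟨i - 1, by omega⟩) (k' := k) (l' := i) (fun h => ?_)
      (Nat.sub_le _ _) m P
    have := congrArg Fin.val (Prod.ext_iff.1 h).2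
    simp only at this
    omega
  have h5 : (kap r γ i * m) • sM n r (i, i) m P =
      -((kap r γ i) • ((-(m : ℂ)) • aStar n r i i m P : PXY n)) := by
    rw [neg_smul, smul_neg, neg_neg, smul_smul]
    exact congrArg (fun Q : PXY n => (kap r γ i * m) • Q) (sM_apply i i m P)
  simp only [EM, LinearMap.add_apply, LinearMap.sub_apply, LinearMap.sum_apply,
    LinearMap.smul_apply]
  rw [h1, h2, h3, h4, BM_apply, h5]
  exact (sub_eq_add_neg (G := PXY n) _ _).symm

theorem cartan_eq_pr (i j : Fin n) : cartan n i j = pr i (j, j) := by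
  simp only [cartan, pr, Fin.ext_iff]
  split_ifs <;> omega

theorem heisenbergForm_extendFin {γ : ℂ} {e : Fin n → Fin n → ℂ}
    (he : ∀ i j, ∑ k, e i k * e j k = Bmat n r γ i j) : HeisenbergForm r γ (extendFin e) := by
  intro i j hi hj
  have h := he ⟨i, hi⟩ ⟨j, hj⟩
  rw [Bmat, cartan_eq_pr] at h
  simp only [extendFin, dif_pos hi, dif_pos hj]
  exact h

theorem adjacent_of_cartan {i j : Fin n} (h : cartan n i j = -1) :
    (i : ℕ) + 1 = j ∨ (j : ℕ) + 1 = i := by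
  by_contra h'
  rw [cartan, if_neg h'] at h
  split_ifs at h

theorem lie_lie_apply (S T U : Module.End ℂ (Fock n)) (P : Fock n) :
    ⁅S, ⁅T, U⁆⁆ P = S (T (U P)) - S (U (T P)) - T (U (S P)) + U (T (S P)) := by
  simp only [Ring.lie_def, LinearMap.sub_apply, Module.End.mul_apply, map_sub]
  abel

theorem apply_eq_zero_of_lie_lie {S T U : Module.End ℂ (Fock n)} (h : ⁅S, ⁅T, U⁆⁆ = 0)
    {f g u : PXY n → PXY n} (hS : ∀ P, S P = f P) (hT : ∀ P, T P = g P) (hU : ∀ P, U P = u P)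
    (P : PXY n) : f (g (u P)) - f (u (g P)) - g (u (f P)) + u (g (f P)) = 0 := by
  obtain rfl : (fun P : PXY n => S P) = f := funext hS
  obtain rfl : (fun P : PXY n => T P) = g := funext hT
  obtain rfl : (fun P : PXY n => U P) = u := funext hU
  exact (lie_lie_apply S T U P).symm.trans (LinearMap.congr_fun h P)

end FockModes

/-- R6, Serre relations: if `(α_i|α_j) = −1` then
`[ρ(E_i)_{m₁}, [ρ(E_i)_{m₂}, ρ(E_j)_p]] = 0` and `[ρ(F_i)_{m₁}, [ρ(F_i)_{m₂}, ρ(F_j)_p]] = 0`. -/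
theorem wakimoto_R6 (n r : ℕ) (hn : 1 ≤ n) (hr : r ≤ n)
    (γ : ℂ) (hγ : γ ≠ 0) (e : Fin n → Fin n → ℂ) (lam : Fin n → ℂ)
    (he : ∀ i j, ∑ k, e i k * e j k = Bmat n r γ i j)
    (i j : Fin n) (hij : cartan n i j = -1) (m₁ m₂ p : ℤ) (P : PXY n) :
    (rhoE n r γ e lam i m₁ (rhoE n r γ e lam i m₂ (rhoE n r γ e lam j p P))
      - rhoE n r γ e lam i m₁ (rhoE n r γ e lam j p (rhoE n r γ e lam i m₂ P))
      - rhoE n r γ e lam i m₂ (rhoE n r γ e lam j p (rhoE n r γ e lam i m₁ P))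
      + rhoE n r γ e lam j p (rhoE n r γ e lam i m₂ (rhoE n r γ e lam i m₁ P)) = 0) ∧
    (rhoF n r i m₁ (rhoF n r i m₂ (rhoF n r j p P))
      - rhoF n r i m₁ (rhoF n r j p (rhoF n r i m₂ P))
      - rhoF n r i m₂ (rhoF n r j p (rhoF n r i m₁ P))
      + rhoF n r j p (rhoF n r i m₂ (rhoF n r i m₁ P)) = 0) := by
  have he' := heisenbergForm_extendFin he
  exact ⟨apply_eq_zero_of_lie_lie (serre_E γ _ he' i.isLt j.isLt (adjacent_of_cartan hij) _ _ _)
      (EM_apply γ e lam i m₁) (EM_apply γ e lam i m₂) (EM_apply γ e lam j p) P,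
    apply_eq_zero_of_lie_lie (serre_F i.isLt j.isLt _ _ _)
      (FM_apply i m₁) (FM_apply i m₂) (FM_apply j p) P⟩
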